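/- arXiv:1703.04950 — 2 statements merged into one kernel-verified Lean document; each statement's English description precedes it below -/
import Mathlib

section
/- There are no integers x, y and integers z1, z2 with 0 ≤ z1 and 0 ≤ z2 such that x^5 + 65·x^4·y − 870·x^3·y^2 − 18990·x^2·y^3 + 26325·x·y^4 + 255069·y^5 = −2^5 · 3^4 · 5^{z1} · 11^{z2}. -/
open NumberField

/-- An integer of prime norm `p` is the kernel generator of a surjection onto `ZMod p`. -/
theorem exists_ringHom_zmod_of_norm {K : Type*} [Field K] [NumberField K] {p : ℕ}
    (hp : p.Prime) (ρ : 𝓞 K) (h : (Algebra.norm ℤ ρ).natAbs = p) :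
    ∃ φ : 𝓞 K →+* ZMod p, ∀ a, φ a = 0 ↔ ρ ∣ a := by
  have hcard : Nat.card (𝓞 K ⧸ Ideal.span {ρ}) = p := by
    rw [← h, ← Ideal.absNorm_span_singleton, Ideal.absNorm_apply, Submodule.cardQuot_apply]
  have : Finite (𝓞 K ⧸ Ideal.span {ρ}) := Nat.finite_of_card_ne_zero (hcard ▸ hp.ne_zero)
  let _ : Fintype (𝓞 K ⧸ Ideal.span {ρ}) := Fintype.ofFinite _
  rw [Nat.card_eq_fintype_card] at hcard
  let ε := ZMod.ringEquivOfPrime (𝓞 K ⧸ Ideal.span {ρ}) hp hcard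
  refine ⟨(ε.symm : 𝓞 K ⧸ Ideal.span {ρ} →+* ZMod p).comp (Ideal.Quotient.mk _), fun a => ?_⟩
  rw [RingHom.comp_apply, RingHom.coe_coe, EmbeddingLike.map_eq_zero_iff,
    Ideal.Quotient.eq_zero_iff_mem, Ideal.mem_span_singleton]

theorem isCoprime_of_map_ne_zero {R : Type*} [CommRing R] {p : ℕ} [Fact p.Prime] {ρ a : R}
    {φ : R →+* ZMod p} (hφ : ∀ a, φ a = 0 ↔ ρ ∣ a) (ha : φ a ≠ 0) : IsCoprime a ρ := by
  obtain ⟨c, hc⟩ : ρ ∣ ((φ a)⁻¹.val : R) * a - 1 := by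
    rw [← hφ, map_sub, map_mul, map_natCast, ZMod.natCast_zmod_val, inv_mul_cancel₀ ha, map_one,
      sub_self]
  exact ⟨((φ a)⁻¹.val : R), -c, by linear_combination hc⟩

theorem dvd_natAbs_norm {K : Type*} [Field K] [NumberField K] (γ : 𝓞 K) :
    γ ∣ ((Algebra.norm ℤ γ).natAbs : 𝓞 K) := by
  rw [← Ideal.mem_span_singleton, ← Ideal.absNorm_span_singleton]
  exact Ideal.absNorm_mem _

theorem natAbs_norm_natCast {K : Type*} [Field K] [NumberField K] (m : ℕ) :
    (Algebra.norm ℤ (m : 𝓞 K)).natAbs = m ^ Module.finrank ℚ K := by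
  have h := Algebra.norm_algebraMap_of_basis (RingOfIntegers.basis K) (m : ℤ)
  rw [← Module.finrank_eq_card_chooseBasisIndex, RingOfIntegers.rank] at h
  rw [← Int.natAbs_natCast m, ← Int.natAbs_pow, ← h]
  simp

/-- If `ρ` has prime norm `p` and the other primes above `p` do not divide `γ`, then the
exponent of `p` in the norm of `γ` is the exponent of `ρ` in `γ`. -/
theorem exists_eq_pow_mul_of_norm {K : Type*} [Field K] [NumberField K] {p : ℕ} [Fact p.Prime]
    {ρ c : 𝓞 K} {n : ℕ} (hρ : (Algebra.norm ℤ ρ).natAbs = p) (hdvd : (p : 𝓞 K) ∣ ρ ^ n * c)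
    {m : ℕ} (hm : ¬ p ∣ m) (k : ℕ) {γ : 𝓞 K} (hc : IsCoprime γ c)
    (hN : (Algebra.norm ℤ γ).natAbs = p ^ k * m) :
    ∃ δ, γ = ρ ^ k * δ ∧ (Algebra.norm ℤ δ).natAbs = m := by
  have hp : p.Prime := Fact.out
  obtain ⟨φ, hφ⟩ := exists_ringHom_zmod_of_norm hp ρ hρ
  induction k generalizing γ with
  | zero => exact ⟨γ, by simp, by simpa using hN⟩
  | succ k ih =>
    have hdiv : ρ ∣ γ := by
      by_contra hnd
      have h1 : IsCoprime γ (ρ ^ n * c) :=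
        ((isCoprime_of_map_ne_zero hφ (mt (hφ γ).1 hnd)).pow_right).mul_right hc
      have h2 : IsCoprime γ ((p : 𝓞 K) ^ (k + 1)) :=
        (h1.of_isCoprime_of_dvd_right hdvd).pow_right
      have h3 : γ ∣ (m : 𝓞 K) := by
        have := dvd_natAbs_norm γ
        rw [hN] at this
        push_cast at this
        exact h2.dvd_of_dvd_mul_left this
      have h4 := Int.natAbs_dvd_natAbs.2 (map_dvd (Algebra.norm ℤ) h3)
      rw [natAbs_norm_natCast, hN] at h4
      exact hm (hp.dvd_of_dvd_pow
        (((dvd_pow_self p k.succ_ne_zero).mul_right m).trans h4))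
    obtain ⟨γ', rfl⟩ := hdiv
    have hN' : (Algebra.norm ℤ γ').natAbs = p ^ k * m := by
      rw [map_mul, Int.natAbs_mul, hρ, pow_succ'] at hN
      exact Nat.eq_of_mul_eq_mul_left hp.pos (by rw [hN, mul_assoc])
    obtain ⟨δ, hδ, hδN⟩ := ih (hc.of_mul_left_right) hN'
    exact ⟨δ, by rw [hδ, pow_succ', mul_assoc], hδN⟩

theorem rank_lt_finrank (K : Type*) [Field K] [NumberField K] :
    Units.rank K < Module.finrank ℚ K := by
  have h1 := InfinitePlace.card_add_two_mul_card_eq_rank K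
  have h2 := InfinitePlace.card_eq_nrRealPlaces_add_nrComplexPlaces K
  have h3 : 0 < Module.finrank ℚ K := Module.finrank_pos
  unfold Units.rank
  omega

/-- In a number field of odd degree, units that are independent modulo `p`-th powers and at least
as numerous as the unit rank generate all units modulo `p`-th powers. -/
theorem exists_eq_prod_mul_pow {K : Type*} [Field K] [NumberField K] {p d : ℕ} [Fact p.Prime]
    (hodd : Odd (Module.finrank ℚ K)) (hp : Odd p) (hd : Module.finrank ℚ K = d + 1)
    (e : Fin d → (𝓞 K)ˣ)
    (he : ∀ (a : Fin d → ZMod p) (v : (𝓞 K)ˣ), ∏ i, e i ^ (a i).val = v ^ p → a = 0)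
    (u : (𝓞 K)ˣ) : ∃ (a : Fin d → ZMod p) (v : (𝓞 K)ˣ), u = (∏ i, e i ^ (a i).val) * v ^ p := by
  have hrep : ∀ u : (𝓞 K)ˣ, ∃ n : Fin (Units.rank K) → ℤ, ∃ w : (𝓞 K)ˣ,
      u = (∏ i, Units.fundSystem K i ^ n i) * w ^ p := fun u => by
    obtain ⟨⟨ζ, n⟩, h, -⟩ := Units.exist_unique_eq_mul_prod K u
    refine ⟨n, ζ, ?_⟩
    have hζ : (ζ : (𝓞 K)ˣ) ^ p = ζ := by
      rcases Units.torsion_eq_one_or_neg_one_of_odd_finrank hodd ζ with h | h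
      · rw [h, one_pow]
      · rw [h, hp.neg_one_pow]
    rw [hζ, mul_comm]
    exact h
  choose n w hn using hrep
  have key : ∀ (u : (𝓞 K)ˣ) (m : Fin (Units.rank K) → ℤ) (w' : (𝓞 K)ˣ) (a : Fin d → ZMod p),
      u = (∏ i, Units.fundSystem K i ^ m i) * w' ^ p →
      (∀ i, ∑ j, (n (e j) i : ZMod p) * a j = m i) →
      ∃ v : (𝓞 K)ˣ, u = (∏ i, e i ^ (a i).val) * v ^ p := by
    intro u m w' a hu ha
    have hk : ∀ i, ∃ k : ℤ, m i = ∑ j, n (e j) i * (a j).val + k * p := fun i => by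
      have : ((m i - ∑ j, n (e j) i * (a j).val : ℤ) : ZMod p) = 0 := by
        push_cast
        simp [← ha i]
      obtain ⟨k, hk⟩ := (ZMod.intCast_zmod_eq_zero_iff_dvd _ p).1 this
      exact ⟨k, by linarith⟩
    choose k hk using hk
    refine ⟨(∏ i, Units.fundSystem K i ^ k i) * w' * (∏ j, w (e j) ^ (a j).val)⁻¹, ?_⟩
    have hprod : ∏ j, e j ^ (a j).val =
        (∏ i, Units.fundSystem K i ^ (∑ j, n (e j) i * ((a j).val : ℤ))) *
          (∏ j, w (e j) ^ (a j).val) ^ p := by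
      have h1 : ∀ j, e j ^ (a j).val =
          (∏ i, Units.fundSystem K i ^ (n (e j) i * ((a j).val : ℤ))) *
            (w (e j) ^ (a j).val) ^ p := fun j => by
        conv_lhs => rw [hn (e j)]
        rw [mul_pow, ← pow_mul, ← pow_mul, mul_comm p, ← Finset.prod_pow]
        simp only [zpow_mul, zpow_natCast]
      rw [Finset.prod_congr rfl fun j _ => h1 j, Finset.prod_mul_distrib, Finset.prod_comm,
        Finset.prod_pow]
      congr 1
      refine Finset.prod_congr rfl fun i _ => ?_
      exact (map_sum (zmultiplesHom (Additive (𝓞 K)ˣ)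
        (Additive.ofMul (Units.fundSystem K i))) _ _).symm
    rw [hu, hprod]
    simp only [hk, zpow_add, zpow_mul, zpow_natCast, Finset.prod_mul_distrib, Finset.prod_pow,
      mul_pow, inv_pow]
    rw [mul_mul_mul_comm, mul_assoc, mul_assoc, mul_assoc]
    simp [mul_comm]
  let M : Matrix (Fin (Units.rank K)) (Fin d) (ZMod p) := Matrix.of fun i j => (n (e j) i : ZMod p)
  have hinj : Function.Injective (Matrix.mulVecLin M) := by
    rw [injective_iff_map_eq_zero]
    intro a ha
    obtain ⟨v, hv⟩ := key 1 0 1 a (by simp) fun i => by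
      simpa [M, Matrix.mulVec, dotProduct] using congrFun ha i
    exact he a v⁻¹ (by rw [inv_pow]; exact eq_inv_of_mul_eq_one_left hv.symm)
  have hrank : d = Units.rank K := by
    have h1 := LinearMap.finrank_le_finrank_of_injective hinj
    have h2 := rank_lt_finrank K
    simp only [Module.finrank_fintype_fun_eq_card, Fintype.card_fin] at h1
    omega
  have hsurj := (LinearMap.injective_iff_surjective_of_finrank_eq_finrank (by simpa using hrank)).1
    hinj
  obtain ⟨a, ha⟩ := hsurj fun i => (n u i : ZMod p)
  obtain ⟨v, hv⟩ := key u (n u) (w u) a (hn u) fun i => by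
    simpa [M, Matrix.mulVec, dotProduct] using congrFun ha i
  exact ⟨a, v, hv⟩

open Polynomial

/-- The polynomial of `τ`, in the shifted variable `τ + 1`. -/
noncomputable def shiftedPoly : ℤ[X] :=
  X ^ 5 - C 5 * X ^ 4 - C 10 * X ^ 3 + C 50 * X ^ 2 + C 25 * X - C 85

theorem natDegree_shiftedPoly : shiftedPoly.natDegree = 5 := by
  unfold shiftedPoly; compute_degree!

theorem monic_shiftedPoly : shiftedPoly.Monic := by
  unfold shiftedPoly; monicity!

theorem irreducible_shiftedPoly : Irreducible shiftedPoly := by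
  have hc : ∀ n, shiftedPoly.coeff n = (if n = 5 then 1 else 0) - 5 * (if n = 4 then 1 else 0)
      - 10 * (if n = 3 then 1 else 0) + 50 * (if n = 2 then 1 else 0)
      + 25 * (if n = 1 then 1 else 0) - 85 * (if n = 0 then 1 else 0) := fun n => by
    simp only [shiftedPoly, coeff_sub, coeff_add, coeff_C_mul, coeff_X_pow, coeff_X, coeff_C,
      eq_comm (a := 1) (b := n), mul_ite, mul_one, mul_zero]
  refine irreducible_of_eisenstein_criterion (P := Ideal.span {(5 : ℤ)}) ?_ ?_ ?_ ?_ ?_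
    monic_shiftedPoly.isPrimitive
  · rw [Ideal.span_singleton_prime (by norm_num)]
    exact Int.prime_iff_natAbs_prime.2 (by norm_num)
  · rw [monic_shiftedPoly.leadingCoeff, Ideal.mem_span_singleton]
    norm_num
  · intro n hn
    rw [degree_eq_natDegree monic_shiftedPoly.ne_zero, natDegree_shiftedPoly, Nat.cast_lt] at hn
    rw [Ideal.mem_span_singleton, hc]
    interval_cases n <;> norm_num
  · rw [degree_eq_natDegree monic_shiftedPoly.ne_zero, natDegree_shiftedPoly]
    norm_num
  · rw [Ideal.span_singleton_pow, Ideal.mem_span_singleton, hc]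
    norm_num

/-- A defining polynomial of the quintic field in which the form splits off a linear factor. -/
noncomputable def tauPoly : ℚ[X] := X ^ 5 - C 20 * X ^ 3 + C 80 * X - C 24

theorem natDegree_tauPoly : tauPoly.natDegree = 5 := by
  unfold tauPoly; compute_degree!

theorem irreducible_tauPoly : Irreducible tauPoly := by
  have h := (monic_shiftedPoly.irreducible_iff_irreducible_map_fraction_map (K := ℚ)).1
    irreducible_shiftedPoly
  rw [← MulEquiv.irreducible_iff (algEquivAevalXAddC (1 : ℚ))] at h
  convert h using 1
  simp only [shiftedPoly, tauPoly, algEquivAevalXAddC, algEquivOfCompEqX_apply, Polynomial.map_sub,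
    Polynomial.map_add, Polynomial.map_mul, Polynomial.map_pow, map_X, map_sub, map_add,
    map_mul, map_pow, aeval_X, Polynomial.map_ofNat, map_ofNat, map_one]
  ring

instance : Fact (Irreducible tauPoly) := ⟨irreducible_tauPoly⟩

/-- The quintic field. -/
def TauField : Type := AdjoinRoot tauPoly

noncomputable instance : Field TauField := inferInstanceAs (Field (AdjoinRoot tauPoly))

instance : CharZero TauField := inferInstanceAs (CharZero (AdjoinRoot tauPoly))

/-- The power basis of the quintic field. -/
noncomputable def tauBasis : PowerBasis ℚ TauField :=
  AdjoinRoot.powerBasis irreducible_tauPoly.ne_zero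

theorem tauBasis_dim : tauBasis.dim = 5 :=
  (AdjoinRoot.powerBasis_dim irreducible_tauPoly.ne_zero).trans natDegree_tauPoly

instance : FiniteDimensional ℚ TauField := tauBasis.finite

instance : NumberField TauField where

theorem finrank_tauField : Module.finrank ℚ TauField = 5 := by
  rw [tauBasis.finrank, tauBasis_dim]

theorem tauBasis_gen_root :
    tauBasis.gen ^ 5 - 20 * tauBasis.gen ^ 3 + 80 * tauBasis.gen - 24 = 0 := by
  have h : aeval tauBasis.gen tauPoly = 0 := AdjoinRoot.eval₂_root tauPoly
  simpa [tauPoly] using h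

/-- The generator of the field. -/
noncomputable def tau : 𝓞 TauField :=
  ⟨tauBasis.gen, X ^ 5 - C 20 * X ^ 3 + C 80 * X - C 24, by monicity!, by
    simpa using tauBasis_gen_root⟩

/-- Half the square of the generator. -/
noncomputable def sigma : 𝓞 TauField :=
  ⟨tauBasis.gen ^ 2 / 2, X * (X ^ 2 - C 10 * X + C 20) ^ 2 - C 18, by monicity!, by
    simp only [eval₂_sub, eval₂_mul, eval₂_pow, eval₂_add, eval₂_X, eval₂_ofNat, map_ofNat]
    linear_combination (1 / 32 : TauField) * (tauBasis.gen ^ 5 - 20 * tauBasis.gen ^ 3 +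
      80 * tauBasis.gen + 24) * tauBasis_gen_root⟩

theorem coe_tau : (tau : TauField) = tauBasis.gen := rfl

theorem coe_sigma : (sigma : TauField) = tauBasis.gen ^ 2 / 2 := rfl

theorem tau_sq : tau ^ 2 = 2 * sigma := by
  refine RingOfIntegers.ext ?_
  simp [coe_tau, coe_sigma, map_ofNat]
  ring

theorem tau_mul_sigma_sq : tau * sigma ^ 2 = 10 * (tau * sigma) - 20 * tau + 6 := by
  refine RingOfIntegers.ext ?_
  simp [coe_tau, coe_sigma, map_ofNat]
  linear_combination (1 / 4 : TauField) * tauBasis_gen_root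

theorem sigma_cubed : sigma ^ 3 = 10 * sigma ^ 2 - 20 * sigma + 3 * tau := by
  have h : (2 : 𝓞 TauField) * (sigma ^ 3 - (10 * sigma ^ 2 - 20 * sigma + 3 * tau)) = 0 := by
    linear_combination tau * tau_mul_sigma_sq - (sigma ^ 2 - 10 * sigma + 20) * tau_sq
  exact sub_eq_zero.1 ((mul_eq_zero.1 h).resolve_left two_ne_zero)

/-- The integer with given coordinates in the basis `1, τ, σ, τσ, σ²`. -/
noncomputable def coord (a b c d e : ℤ) : 𝓞 TauField :=
  a + b * tau + c * sigma + d * (tau * sigma) + e * sigma ^ 2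

theorem coord_mul (a b c d e a' b' c' d' e' : ℤ) :
    coord a b c d e * coord a' b' c' d' e' =
      coord (a * a' + 6 * e * b' + 6 * d * c' + (6 * c + 60 * e) * d' + (6 * b + 60 * d) * e')
        (b * a' + (a - 20 * e) * b' + (-20 * d + 3 * e) * c' + (-20 * c + 6 * d - 200 * e) * d' +
          (-20 * b + 3 * c - 200 * d + 30 * e) * e')
        (c * a' + 2 * b * b' + (a - 20 * e) * c' + (-40 * d + 6 * e) * d' +
          (-20 * c + 6 * d - 200 * e) * e')
        (d * a' + (c + 10 * e) * b' + (b + 10 * d) * c' + (a + 10 * c + 80 * e) * d' +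
          (10 * b + 80 * d + 3 * e) * e')
        (e * a' + 2 * d * b' + (c + 10 * e) * c' + (2 * b + 20 * d) * d' +
          (a + 10 * c + 80 * e) * e') := by
  have h4 : tau * sigma ^ 3 = 60 - 200 * tau + 6 * sigma + 80 * (tau * sigma) := by
    linear_combination (sigma + 10) * tau_mul_sigma_sq
  have h5 : sigma ^ 4 = 30 * tau - 200 * sigma + 3 * (tau * sigma) + 80 * sigma ^ 2 := by
    linear_combination (sigma + 10) * sigma_cubed
  unfold coord
  push_cast
  linear_combination (b * b' + b * d' * sigma + d * b' * sigma + d * d' * sigma ^ 2) * tau_sq +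
    (b * e' + c * d' + d * c' + e * b') * tau_mul_sigma_sq +
    (c * e' + e * c' + 2 * d * d') * sigma_cubed + (d * e' + e * d') * h4 + e * e' * h5

/-- The matrix of multiplication by `coord a b c d e`. -/
def mulMatrix (a b c d e : ℤ) : Matrix (Fin 5) (Fin 5) ℤ :=
  !![a, 6 * e, 6 * d, 6 * c + 60 * e, 6 * b + 60 * d;
    b, a - 20 * e, -20 * d + 3 * e, -20 * c + 6 * d - 200 * e,
      -20 * b + 3 * c - 200 * d + 30 * e;
    c, 2 * b, a - 20 * e, -40 * d + 6 * e, -20 * c + 6 * d - 200 * e;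
    d, c + 10 * e, b + 10 * d, a + 10 * c + 80 * e, 10 * b + 80 * d + 3 * e;
    e, 2 * d, c + 10 * e, 2 * b + 20 * d, a + 10 * c + 80 * e]

theorem norm_coord (a b c d e : ℤ) :
    Algebra.norm ℤ (coord a b c d e) = (mulMatrix a b c d e).det := by
  let w : Fin 5 → ℚˣ := ![1, 1, Units.mk0 (1 / 2) (by norm_num), Units.mk0 (1 / 2) (by norm_num),
    Units.mk0 (1 / 4) (by norm_num)]
  let v : Module.Basis (Fin 5) ℚ TauField :=
    (tauBasis.basis.reindex (finCongr tauBasis_dim)).unitsSMul w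
  have hv : ∀ j, v j = ((![coord 1 0 0 0 0, coord 0 1 0 0 0, coord 0 0 1 0 0, coord 0 0 0 1 0,
      coord 0 0 0 0 1] j : 𝓞 TauField) : TauField) := fun j => by
    simp only [v, Module.Basis.unitsSMul_apply, Module.Basis.reindex_apply,
      PowerBasis.basis_eq_pow]
    fin_cases j <;>
      simp [w, coord, coe_tau, coe_sigma, map_ofNat, Units.smul_def, Algebra.smul_def] <;> ring
  have hM : Algebra.leftMulMatrix v (coord a b c d e : TauField) =
      (mulMatrix a b c d e).map (Int.castRingHom ℚ) := by
    ext i j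
    have h : (coord a b c d e : TauField) * v j =
        ∑ i, ((mulMatrix a b c d e i j : ℤ) : ℚ) • v i := by
      simp only [hv, Algebra.smul_def, Fin.sum_univ_five, ← map_mul]
      fin_cases j <;> simp [mulMatrix, coord_mul] <;> simp [coord, map_ofNat]
    rw [Algebra.leftMulMatrix_eq_repr_mul, h]
    simp [Finsupp.single_apply]
  have := Algebra.coe_norm_int (coord a b c d e)
  rw [Algebra.norm_eq_matrix_det v, hM, ← RingHom.mapMatrix_apply, ← RingHom.map_det,
    eq_intCast] at this
  exact_mod_cast this

theorem ofNat_eq_coord (n : ℕ) [n.AtLeastTwo] :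
    (OfNat.ofNat n : 𝓞 TauField) = coord (OfNat.ofNat n) 0 0 0 0 := by
  simp [coord]

/-- A generator of the prime above `2`. -/
noncomputable def piTwo : 𝓞 TauField := coord 2 (-7) 7 1 (-1)

/-- A generator of the degree-one prime above `3`. -/
noncomputable def piThree : 𝓞 TauField := coord 15 0 (-9) 0 1

/-- The cofactor of `piThree` in `3`. -/
noncomputable def coThree : 𝓞 TauField := coord (-7) 21 17 (-3) (-2)

/-- A generator of the prime above `5`. -/
noncomputable def piFive : 𝓞 TauField := coord 17 (-1) (-9) 0 1

/-- A generator of the unramified prime above `11`. -/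
noncomputable def piEleven : 𝓞 TauField := coord (-5) 16 2 (-2) 0

/-- A generator of the prime `(11, τ - 5)`. -/
noncomputable def ramFive : 𝓞 TauField := coord 7 0 (-1) 0 0

/-- A generator of the prime `(11, τ - 8)`. -/
noncomputable def ramEight : 𝓞 TauField := coord 19 (-1) (-10) 0 1

/-- The linear factor `x - θ y` of the form. -/
noncomputable def linForm (x y : ℤ) : 𝓞 TauField :=
  coord (x + 77 * y) (-6 * y) (-40 * y) 0 (4 * y)

/-- Four units that are independent modulo fifth powers. -/
noncomputable def basicUnit : Fin 4 → (𝓞 TauField)ˣ :=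
  ![Units.mkOfMulEqOne (coord 13 (-1) (-8) 0 1) (coord 109 (-405) 312 61 (-47))
      (by rw [coord_mul]; norm_num [coord]),
    Units.mkOfMulEqOne (coord 13 (-7) (-2) 1 0) (coord 1 (-3) 0 1 0)
      (by rw [coord_mul]; norm_num [coord]),
    Units.mkOfMulEqOne (coord (-7) 10 (-4) (-2) 1) (coord 29 (-90) (-46) 37 19)
      (by rw [coord_mul]; norm_num [coord]),
    Units.mkOfMulEqOne (coord (-148781) 481740 244045 (-197465) (-101200))
      (coord 352729 (-1311815) 1011955 197590 (-152425)) (by rw [coord_mul]; norm_num [coord])]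

theorem norm_linForm (x y : ℤ) : Algebra.norm ℤ (linForm x y) =
    x ^ 5 + 65 * x ^ 4 * y - 870 * x ^ 3 * y ^ 2 - 18990 * x ^ 2 * y ^ 3 +
      26325 * x * y ^ 4 + 255069 * y ^ 5 := by
  rw [linForm, norm_coord]
  simp [mulMatrix, Matrix.det_succ_row_zero, Fin.sum_univ_succ, Fin.succAbove]
  ring

theorem norm_piTwo : (Algebra.norm ℤ piTwo).natAbs = 2 := by
  rw [piTwo, norm_coord]; decide +kernel

theorem norm_piThree : (Algebra.norm ℤ piThree).natAbs = 3 := by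
  rw [piThree, norm_coord]; decide +kernel

theorem norm_coThree : (Algebra.norm ℤ coThree).natAbs = 81 := by
  rw [coThree, norm_coord]; decide +kernel

theorem norm_piFive : (Algebra.norm ℤ piFive).natAbs = 5 := by
  rw [piFive, norm_coord]; decide +kernel

theorem norm_piEleven : (Algebra.norm ℤ piEleven).natAbs = 11 := by
  rw [piEleven, norm_coord]; decide +kernel

theorem two_dvd_piTwo_pow : (2 : 𝓞 TauField) ∣ piTwo ^ 5 := by
  refine ⟨coord 352729 (-1311815) 1011955 197590 (-152425), ?_⟩
  simp only [piTwo, pow_succ, pow_zero, one_mul, coord_mul, ofNat_eq_coord]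
  norm_num

theorem piThree_mul_coThree : piThree * coThree = 3 := by
  simp only [piThree, coThree, coord_mul, ofNat_eq_coord]
  norm_num

theorem five_dvd_piFive_pow : (5 : 𝓞 TauField) ∣ piFive ^ 5 := by
  refine ⟨coord 239455 (-18575) (-122147) 1829 12293, ?_⟩
  simp only [piFive, pow_succ, pow_zero, one_mul, coord_mul, ofNat_eq_coord]
  norm_num

theorem eleven_dvd : (11 : 𝓞 TauField) ∣ piEleven * (ramFive ^ 2 * ramEight ^ 2) := by
  refine ⟨coord (-31) 8 12 (-1) (-1), ?_⟩
  simp only [piEleven, ramFive, ramEight, pow_succ, pow_zero, one_mul, coord_mul, ofNat_eq_coord]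
  norm_num

/-- A ring homomorphism to a prime field of odd characteristic, on coordinates. -/
theorem exists_hom_coord {p : ℕ} [Fact p.Prime] {a b c d e : ℤ} (r s : ℤ)
    (a' b' c' d' e' : ℤ) (hN : (mulMatrix a b c d e).det.natAbs = p)
    (hr : coord a b c d e * coord a' b' c' d' e' = coord (-r) 1 0 0 0)
    (h2 : p ≠ 2) (hs : (p : ℤ) ∣ 2 * s - r ^ 2) :
    ∃ φ : 𝓞 TauField →+* ZMod p, (∀ η, φ η = 0 ↔ coord a b c d e ∣ η) ∧
      ∀ k l m n q : ℤ,
        φ (coord k l m n q) = ((k + l * r + m * s + n * (r * s) + q * s ^ 2 : ℤ) : ZMod p) := by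
  obtain ⟨φ, hφ⟩ := exists_ringHom_zmod_of_norm (p := p) Fact.out (coord a b c d e)
    ((congrArg Int.natAbs (norm_coord a b c d e)).trans hN)
  have hτ : φ tau = r := by
    have h := (hφ (coord (-r) 1 0 0 0)).2 ⟨_, hr.symm⟩
    simp only [coord, Int.cast_neg, Int.cast_one, Int.cast_zero, zero_mul, add_zero, one_mul,
      map_add, map_neg, map_intCast] at h
    linear_combination h
  have h2' : (2 : ZMod p) ≠ 0 := Ring.two_ne_zero (by rwa [ZMod.ringChar_zmod_n])
  have hσ : φ sigma = s := by
    have h := congrArg φ tau_sq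
    have hs' := (ZMod.intCast_zmod_eq_zero_iff_dvd _ p).2 hs
    rw [map_pow, hτ, map_mul, map_ofNat] at h
    push_cast at hs'
    exact mul_left_cancel₀ h2' (by linear_combination -h - hs')
  exact ⟨φ, hφ, fun k l m n q => by simp [coord, hτ, hσ]⟩

instance : Fact (Nat.Prime 5) := ⟨by norm_num⟩

instance : Fact (Nat.Prime 11) := ⟨by norm_num⟩

instance : Fact (Nat.Prime 181) := ⟨by norm_num⟩

theorem exists_hom_five : ∃ φ : 𝓞 TauField →+* ZMod 5, (∀ η, φ η = 0 ↔ piFive ∣ η) ∧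
    ∀ k l m n q : ℤ,
      φ (coord k l m n q) = ((k + l * 4 + m * 3 + n * (4 * 3) + q * 3 ^ 2 : ℤ) : ZMod 5) :=
  exists_hom_coord 4 3 (-8) 23 16 (-3) (-2) (by decide +kernel) (by rw [coord_mul]; norm_num)
    (by norm_num) (by norm_num)

theorem exists_hom_ramFive : ∃ φ : 𝓞 TauField →+* ZMod 11, (∀ η, φ η = 0 ↔ ramFive ∣ η) ∧
    ∀ k l m n q : ℤ,
      φ (coord k l m n q) = ((k + l * 5 + m * 7 + n * (5 * 7) + q * 7 ^ 2 : ℤ) : ZMod 11) :=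
  exists_hom_coord 5 7 1 (-6) 3 2 (-1) (by decide +kernel) (by rw [coord_mul]; norm_num)
    (by norm_num) (by norm_num)

theorem exists_hom_ramEight : ∃ φ : 𝓞 TauField →+* ZMod 11, (∀ η, φ η = 0 ↔ ramEight ∣ η) ∧
    ∀ k l m n q : ℤ,
      φ (coord k l m n q) = ((k + l * 8 + m * 10 + n * (8 * 10) + q * 10 ^ 2 : ℤ) : ZMod 11) :=
  exists_hom_coord 8 10 (-2) 3 14 0 (-2) (by decide +kernel) (by rw [coord_mul]; norm_num)
    (by norm_num) (by norm_num)

/-- The images of `τ` in the five residue fields above `181`. -/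
def rootMod : Fin 5 → ℤ := ![87, 99, 114, 116, 127]

/-- The value in `ℤ` inducing the reduction of `coord k l m n q` at the prime
`(181, τ - rootMod i)`. -/
def evalMod (i : Fin 5) (k l m n q : ℤ) : ℤ :=
  k + l * rootMod i + m * (91 * rootMod i ^ 2) + n * (rootMod i * (91 * rootMod i ^ 2)) +
    q * (91 * rootMod i ^ 2) ^ 2

theorem exists_hom_evalMod (i : Fin 5) : ∃ φ : 𝓞 TauField →+* ZMod 181,
    ∀ k l m n q : ℤ, φ (coord k l m n q) = (evalMod i k l m n q : ZMod 181) := by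
  have hs : ((181 : ℕ) : ℤ) ∣ 2 * (91 * rootMod i ^ 2) - rootMod i ^ 2 :=
    ⟨rootMod i ^ 2, by push_cast; ring⟩
  fin_cases i
  · obtain ⟨φ, -, h⟩ := exists_hom_coord (p := 181) (a := 17) (b := -8) (c := -2) (d := 1) (e := 0)
      87 _ 9 (-41) (-50) (-3) 2 (by decide +kernel) (by rw [coord_mul]; norm_num) (by norm_num) hs
    exact ⟨φ, h⟩
  · obtain ⟨φ, -, h⟩ := exists_hom_coord (p := 181) (a := 5) (b := 1) (c := -1) (d := 0) (e := 0)
      99 _ (-9) (-37) 33 4 (-5) (by decide +kernel) (by rw [coord_mul]; norm_num) (by norm_num) hs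
    exact ⟨φ, h⟩
  · obtain ⟨φ, -, h⟩ := exists_hom_coord (p := 181) (a := 5) (b := 5) (c := -7) (d := -1) (e := 1)
      114 _ 30 (-141) (-114) 21 16 (by decide +kernel) (by rw [coord_mul]; norm_num)
      (by norm_num) hs
    exact ⟨φ, h⟩
  · obtain ⟨φ, -, h⟩ := exists_hom_coord (p := 181) (a := 5) (b := -19) (c := 5) (d := 3) (e := -1)
      116 _ 260 (-149) (-180) 57 40 (by decide +kernel) (by rw [coord_mul]; norm_num)
      (by norm_num) hs
    exact ⟨φ, h⟩
  · obtain ⟨φ, -, h⟩ := exists_hom_coord (p := 181) (a := -11) (b := -3) (c := 3) (d := 0) (e := 0)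
      127 _ (-229) 739 369 (-300) (-153) (by decide +kernel) (by rw [coord_mul]; norm_num)
      (by norm_num) hs
    exact ⟨φ, h⟩

theorem coe_basicUnit (j : Fin 4) : (basicUnit j : 𝓞 TauField) =
    ![coord 13 (-1) (-8) 0 1, coord 13 (-7) (-2) 1 0, coord (-7) 10 (-4) (-2) 1,
      coord (-148781) 481740 244045 (-197465) (-101200)] j := by
  fin_cases j <;> rfl

/-- The thirty-sixth powers of the images of `basicUnit` in the residue fields above `181`. -/
def unitTable : Fin 5 → Fin 4 → ZMod 181 :=
  ![![42, 59, 125, 59], ![59, 42, 125, 59], ![59, 59, 125, 59], ![42, 125, 125, 59],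
    ![135, 125, 125, 59]]

theorem map_basicUnit_pow {i : Fin 5} {φ : 𝓞 TauField →+* ZMod 181}
    (hφ : ∀ k l m n q : ℤ, φ (coord k l m n q) = (evalMod i k l m n q : ZMod 181)) (j : Fin 4) :
    φ (basicUnit j) ^ 36 = unitTable i j := by
  rw [coe_basicUnit]
  fin_cases j <;> simp only [Fin.zero_eta, Fin.mk_one, Fin.reduceFinMk, Matrix.cons_val, hφ] <;>
    clear hφ <;> revert i <;> decide +kernel

theorem map_basicUnit_ramFive {φ : 𝓞 TauField →+* ZMod 11}
    (hφ : ∀ k l m n q : ℤ,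
      φ (coord k l m n q) = ((k + l * 5 + m * 7 + n * (5 * 7) + q * 7 ^ 2 : ℤ) : ZMod 11))
    (j : Fin 4) : φ (basicUnit j) ^ 2 = ![1, 1, 3, 4] j := by
  rw [coe_basicUnit]
  fin_cases j <;> simp only [Fin.zero_eta, Fin.mk_one, Fin.reduceFinMk, Matrix.cons_val, hφ] <;>
    decide +kernel

theorem map_basicUnit_ramEight {φ : 𝓞 TauField →+* ZMod 11}
    (hφ : ∀ k l m n q : ℤ,
      φ (coord k l m n q) = ((k + l * 8 + m * 10 + n * (8 * 10) + q * 10 ^ 2 : ℤ) : ZMod 11))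
    (j : Fin 4) : φ (basicUnit j) ^ 2 = ![9, 3, 3, 4] j := by
  rw [coe_basicUnit]
  fin_cases j <;> simp only [Fin.zero_eta, Fin.mk_one, Fin.reduceFinMk, Matrix.cons_val, hφ] <;>
    decide +kernel

theorem eq_zero_of_residues : ∀ a₀ a₁ a₂ a₃ : ZMod 5,
    (∀ i ∈ ({0, 1, 2} : Finset (Fin 5)), unitTable i 0 ^ a₀.val * unitTable i 1 ^ a₁.val *
      unitTable i 2 ^ a₂.val * unitTable i 3 ^ a₃.val = 1) →
    (1 : ZMod 11) ^ a₀.val * 1 ^ a₁.val * 3 ^ a₂.val * 4 ^ a₃.val = 1 →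
    a₀ = 0 ∧ a₁ = 0 ∧ a₂ = 0 ∧ a₃ = 0 := by
  decide +kernel

theorem basicUnit_independent (a : Fin 4 → ZMod 5) (v : (𝓞 TauField)ˣ)
    (h : ∏ i, basicUnit i ^ (a i).val = v ^ 5) : a = 0 := by
  have h' := congrArg (Units.val) h
  simp only [Fin.prod_univ_four, Units.val_mul, Units.val_pow_eq_pow_val] at h'
  have h181 : ∀ i : Fin 5, unitTable i 0 ^ (a 0).val * unitTable i 1 ^ (a 1).val *
      unitTable i 2 ^ (a 2).val * unitTable i 3 ^ (a 3).val = 1 := fun i => by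
    obtain ⟨φ, hφ⟩ := exists_hom_evalMod i
    have hv : φ v ^ 180 = 1 := ZMod.pow_card_sub_one_eq_one (v.isUnit.map φ).ne_zero
    have := congrArg (fun η => φ η ^ 36) h'
    simp only [map_mul, map_pow, mul_pow, ← pow_mul, hv] at this
    simpa only [mul_comm _ 36, pow_mul, map_basicUnit_pow hφ] using this
  have h11 : (1 : ZMod 11) ^ (a 0).val * 1 ^ (a 1).val * 3 ^ (a 2).val * 4 ^ (a 3).val = 1 := by
    obtain ⟨φ, -, hφ⟩ := exists_hom_ramFive
    have hv : φ v ^ 10 = 1 := ZMod.pow_card_sub_one_eq_one (v.isUnit.map φ).ne_zero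
    have := congrArg (fun η => φ η ^ 2) h'
    simp only [map_mul, map_pow, mul_pow, ← pow_mul, hv] at this
    simp only [mul_comm _ 2, pow_mul, map_basicUnit_ramFive hφ] at this
    exact this
  obtain ⟨h0, h1, h2, h3⟩ := eq_zero_of_residues _ _ _ _ (fun i _ => h181 i) h11
  ext i
  fin_cases i <;> simp [h0, h1, h2, h3]

theorem exists_unit_eq (u : (𝓞 TauField)ˣ) : ∃ (a : Fin 4 → ZMod 5) (v : (𝓞 TauField)ˣ),
    u = (∏ i, basicUnit i ^ (a i).val) * v ^ 5 :=
  exists_eq_prod_mul_pow (by rw [finrank_tauField]; decide) (by decide) finrank_tauField basicUnit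
    basicUnit_independent u

/-- Elements of norm `± 2 ^ 5 * 5 ^ z₁ * 11 ^ z₂` that avoid the ramified primes above `11`. -/
theorem exists_eq_of_norm {γ : 𝓞 TauField} {z₁ z₂ : ℕ}
    (hN : (Algebra.norm ℤ γ).natAbs = 2 ^ 5 * 5 ^ z₁ * 11 ^ z₂)
    (hc : IsCoprime γ (ramFive ^ 2 * ramEight ^ 2)) :
    ∃ (a : Fin 4 → ZMod 5) (v : (𝓞 TauField)ˣ), γ = (∏ i, (basicUnit i : 𝓞 TauField) ^ (a i).val) *
      piFive ^ z₁ * piEleven ^ z₂ * (piTwo * v) ^ 5 := by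
  obtain ⟨δ, rfl, hδ⟩ := exists_eq_pow_mul_of_norm (p := 11) (n := 1) norm_piEleven
    (by rw [pow_one]; exact_mod_cast eleven_dvd) (m := 2 ^ 5 * 5 ^ z₁)
    (fun h => by
      rcases (Nat.Prime.dvd_mul (by norm_num)).1 h with h | h <;>
        exact absurd (Nat.Prime.dvd_of_dvd_pow (by norm_num) h) (by norm_num))
    z₂ hc (by rw [hN]; ring)
  obtain ⟨ε, rfl, hε⟩ := exists_eq_pow_mul_of_norm (p := 2) (n := 5) norm_piTwo
    (by rw [mul_one]; exact_mod_cast two_dvd_piTwo_pow) (m := 5 ^ z₁)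
    (fun h => absurd (Nat.Prime.dvd_of_dvd_pow (by norm_num) h) (by norm_num))
    5 isCoprime_one_right hδ
  obtain ⟨ζ, rfl, hζ⟩ := exists_eq_pow_mul_of_norm (p := 5) (n := 5) norm_piFive
    (by rw [mul_one]; exact_mod_cast five_dvd_piFive_pow) (m := 1) (by norm_num)
    z₁ isCoprime_one_right (by rw [hε, mul_one])
  have hu := dvd_natAbs_norm ζ
  rw [hζ, Nat.cast_one, ← isUnit_iff_dvd_one] at hu
  obtain ⟨u, rfl⟩ := hu
  obtain ⟨a, v, rfl⟩ := exists_unit_eq u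
  refine ⟨a, v, ?_⟩
  simp only [Units.val_mul, Units.coe_prod, Units.val_pow_eq_pow_val]
  ring

theorem linForm_eq (x y : ℤ) : linForm x y = x - coThree * coord (-373) 26 191 (-2) (-19) * y := by
  simp only [linForm, coThree, coord_mul]
  simp only [coord]
  push_cast
  ring

theorem isCoprime_linForm_ram {x y : ℤ} (h : ¬ (11 : ℤ) ∣ x + 7 * y) :
    IsCoprime (linForm x y) (ramFive ^ 2 * ramEight ^ 2) := by
  have h' : ((x + 7 * y : ℤ) : ZMod 11) ≠ 0 := fun h0 =>
    h ((ZMod.intCast_zmod_eq_zero_iff_dvd _ 11).1 h0)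
  obtain ⟨φ, hφ, hφ'⟩ := exists_hom_ramFive
  obtain ⟨ψ, hψ, hψ'⟩ := exists_hom_ramEight
  refine IsCoprime.mul_right (IsCoprime.pow_right (isCoprime_of_map_ne_zero hφ ?_))
    (IsCoprime.pow_right (isCoprime_of_map_ne_zero hψ ?_))
  · rwa [linForm, hφ', show x + 77 * y + -6 * y * 5 + -40 * y * 7 + 0 * (5 * 7) + 4 * y * 7 ^ 2 =
      x + 7 * y + ((11 : ℕ) : ℤ) * (-4 * y) by push_cast; ring, Int.cast_add, Int.cast_mul,
      Int.cast_natCast, ZMod.natCast_self, zero_mul, add_zero]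
  · rwa [linForm, hψ', show x + 77 * y + -6 * y * 8 + -40 * y * 10 + 0 * (8 * 10) + 4 * y * 10 ^ 2 =
      x + 7 * y + ((11 : ℕ) : ℤ) * (2 * y) by push_cast; ring, Int.cast_add, Int.cast_mul,
      Int.cast_natCast, ZMod.natCast_self, zero_mul, add_zero]

/-- The element that clears the cofactor of `piThree`, together with the integer it introduces. -/
def IsClearing (m : ℕ) (w : 𝓞 TauField) : Prop := m = 1 ∧ w = 1 ∨ m = 3 ∧ w = piThree

/-- The factorization of the linear form attached to a solution. -/
theorem exists_linForm_eq {x y : ℤ} {z₁ z₂ : ℕ} (h11 : ¬ (11 : ℤ) ∣ x + 7 * y)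
    (h : x ^ 5 + 65 * x ^ 4 * y - 870 * x ^ 3 * y ^ 2 - 18990 * x ^ 2 * y ^ 3 +
        26325 * x * y ^ 4 + 255069 * y ^ 5 = -(2 ^ 5 * 3 ^ 4 * 5 ^ z₁ * 11 ^ z₂)) :
    ∃ (a : Fin 4 → ZMod 5) (v : (𝓞 TauField)ˣ) (m : ℕ) (w : 𝓞 TauField),
      IsClearing m w ∧
      linForm x y * w ^ 5 = m * ((∏ i, (basicUnit i : 𝓞 TauField) ^ (a i).val) * piThree ^ 4 *
        piFive ^ z₁ * piEleven ^ z₂ * (piTwo * v) ^ 5) := by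
  have hN : (Algebra.norm ℤ (linForm x y)).natAbs = 2 ^ 5 * 3 ^ 4 * 5 ^ z₁ * 11 ^ z₂ := by
    rw [norm_linForm, h, Int.natAbs_neg]
    exact_mod_cast Int.natAbs_natCast (2 ^ 5 * 3 ^ 4 * 5 ^ z₁ * 11 ^ z₂)
  have hram := isCoprime_linForm_ram h11
  by_cases h3 : (3 : ℤ) ∣ x
  · obtain ⟨t, rfl⟩ := h3
    set γ := piThree * (t : 𝓞 TauField) - coord (-373) 26 191 (-2) (-19) * y with hγ
    have hfac : linForm (3 * t) y = coThree * γ := by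
      rw [linForm_eq, hγ]
      push_cast
      linear_combination -(t : 𝓞 TauField) * piThree_mul_coThree
    rw [hfac] at hN hram
    rw [map_mul, Int.natAbs_mul, norm_coThree] at hN
    obtain ⟨a, v, hav⟩ := exists_eq_of_norm (γ := γ) (z₁ := z₁) (z₂ := z₂)
      (by nlinarith) hram.of_mul_left_right
    refine ⟨a, v, 3, piThree, Or.inr ⟨rfl, rfl⟩, ?_⟩
    rw [hfac, hav, Nat.cast_ofNat, ← piThree_mul_coThree]
    ring
  · have hcop : IsCoprime (linForm x y) coThree := by
      have : IsCoprime (x : 𝓞 TauField) 3 := by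
        have := ((Int.prime_three.coprime_iff_not_dvd).2 h3).symm.map
          (Int.castRingHom (𝓞 TauField))
        simpa using this
      rw [← piThree_mul_coThree] at this
      obtain ⟨r, s, hrs⟩ := this.of_mul_right_right
      refine ⟨r, s + r * coord (-373) 26 191 (-2) (-19) * y, ?_⟩
      rw [linForm_eq]
      linear_combination hrs
    obtain ⟨γ, hγ, hγN⟩ := exists_eq_pow_mul_of_norm (p := 3) (n := 1) norm_piThree
      (by rw [pow_one, piThree_mul_coThree]; norm_num) (m := 2 ^ 5 * 5 ^ z₁ * 11 ^ z₂)
      (fun h => by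
        rcases (Nat.Prime.dvd_mul (by norm_num)).1 h with h | h
        · rcases (Nat.Prime.dvd_mul (by norm_num)).1 h with h | h <;>
            exact absurd (Nat.Prime.dvd_of_dvd_pow (by norm_num) h) (by norm_num)
        · exact absurd (Nat.Prime.dvd_of_dvd_pow (by norm_num) h) (by norm_num))
      4 hcop (by rw [hN]; ring)
    rw [hγ] at hram
    obtain ⟨a, v, hav⟩ := exists_eq_of_norm hγN hram.of_mul_left_right
    refine ⟨a, v, 1, 1, Or.inl ⟨rfl, rfl⟩, ?_⟩
    rw [hγ, hav]
    push_cast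
    ring

theorem prime_int_five : Prime (5 : ℤ) := Int.prime_iff_natAbs_prime.2 (by norm_num)

/-- The root of the Eisenstein polynomial, a uniformizer above `5`. -/
noncomputable def kappa : 𝓞 TauField := coord 1 1 0 0 0

theorem kappa_sq : kappa ^ 2 = coord 1 2 2 0 0 := by
  simp only [kappa, sq, coord_mul]; norm_num

theorem kappa_cubed : kappa ^ 3 = coord 1 3 6 2 0 := by
  rw [pow_succ, kappa_sq, kappa, coord_mul]; norm_num

theorem kappa_fourth : kappa ^ 4 = coord 1 4 12 8 4 := by
  rw [pow_succ, kappa_cubed, kappa, coord_mul]; norm_num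

theorem kappa_fifth :
    kappa ^ 5 = 5 * (kappa ^ 4 + 2 * kappa ^ 3 - 10 * kappa ^ 2 - 5 * kappa + 17) := by
  rw [pow_succ kappa 4, kappa_fourth, kappa_cubed, kappa_sq, kappa, coord_mul]
  simp only [coord]
  push_cast
  ring

theorem not_five_dvd_kappa_fourth : ¬ (5 : 𝓞 TauField) ∣ kappa ^ 4 := by
  rintro ⟨t, ht⟩
  obtain ⟨φ, -, hφ⟩ := exists_hom_five
  have h : kappa ^ 4 + 2 * kappa ^ 3 - 10 * kappa ^ 2 - 5 * kappa + 17 = t * kappa := by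
    have h5 : (5 : 𝓞 TauField) ≠ 0 := by norm_num
    refine mul_left_cancel₀ h5 ?_
    linear_combination -kappa_fifth + kappa * ht
  have hk : φ kappa = 0 := by rw [kappa, hφ]; decide
  have := congrArg φ h
  simp only [map_add, map_sub, map_mul, map_pow, hk, map_ofNat, mul_zero] at this
  revert this
  decide

theorem five_dvd_of_dvd_mul_kappa_fourth {a : ℤ} (h : (5 : 𝓞 TauField) ∣ a * kappa ^ 4) :
    (5 : ℤ) ∣ a := by
  by_contra ha
  obtain ⟨u, v, huv⟩ := prime_int_five.coprime_iff_not_dvd.2 ha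
  have huv' : (u : 𝓞 TauField) * 5 + v * a = 1 := by
    exact_mod_cast congrArg (Int.cast (R := 𝓞 TauField)) huv
  refine not_five_dvd_kappa_fourth ?_
  obtain ⟨t, ht⟩ := h
  exact ⟨u * kappa ^ 4 + v * t, by linear_combination -kappa ^ 4 * huv' + v * ht⟩

theorem five_dvd_coeff {a₀ a₁ a₂ a₃ a₄ : ℤ}
    (h : (5 : 𝓞 TauField) ∣ a₀ + a₁ * kappa + a₂ * kappa ^ 2 + a₃ * kappa ^ 3 + a₄ * kappa ^ 4) :
    (5 : ℤ) ∣ a₀ ∧ (5 : ℤ) ∣ a₁ ∧ (5 : ℤ) ∣ a₂ ∧ (5 : ℤ) ∣ a₃ ∧ (5 : ℤ) ∣ a₄ := by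
  obtain ⟨t, ht⟩ := h
  set g := kappa ^ 4 + 2 * kappa ^ 3 - 10 * kappa ^ 2 - 5 * kappa + 17 with hg
  have hk : kappa ^ 5 = 5 * g := kappa_fifth
  have h₀ : (5 : ℤ) ∣ a₀ := five_dvd_of_dvd_mul_kappa_fourth
    ⟨t * kappa ^ 4 - (a₁ + a₂ * kappa + a₃ * kappa ^ 2 + a₄ * kappa ^ 3) * g, by
      linear_combination kappa ^ 4 * ht - (a₁ + a₂ * kappa + a₃ * kappa ^ 2 + a₄ * kappa ^ 3) * hk⟩
  obtain ⟨b₀, rfl⟩ := h₀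
  push_cast at ht
  have h₁ : (5 : ℤ) ∣ a₁ := five_dvd_of_dvd_mul_kappa_fourth
    ⟨(t - b₀) * kappa ^ 3 - (a₂ + a₃ * kappa + a₄ * kappa ^ 2) * g, by
      linear_combination kappa ^ 3 * ht - (a₂ + a₃ * kappa + a₄ * kappa ^ 2) * hk⟩
  obtain ⟨b₁, rfl⟩ := h₁
  push_cast at ht
  have h₂ : (5 : ℤ) ∣ a₂ := five_dvd_of_dvd_mul_kappa_fourth
    ⟨(t - b₀ - b₁ * kappa) * kappa ^ 2 - (a₃ + a₄ * kappa) * g, by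
      linear_combination kappa ^ 2 * ht - (a₃ + a₄ * kappa) * hk⟩
  obtain ⟨b₂, rfl⟩ := h₂
  push_cast at ht
  have h₃ : (5 : ℤ) ∣ a₃ := five_dvd_of_dvd_mul_kappa_fourth
    ⟨(t - b₀ - b₁ * kappa - b₂ * kappa ^ 2) * kappa - a₄ * g, by
      linear_combination kappa * ht - a₄ * hk⟩
  obtain ⟨b₃, rfl⟩ := h₃
  push_cast at ht
  exact ⟨⟨_, rfl⟩, ⟨_, rfl⟩, ⟨_, rfl⟩, ⟨_, rfl⟩, five_dvd_of_dvd_mul_kappa_fourth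
    ⟨t - b₀ - b₁ * kappa - b₂ * kappa ^ 2 - b₃ * kappa ^ 3, by linear_combination ht⟩⟩

/-- A truncated exponential `∏ exp (lⱼ κʲ)` modulo `5`. -/
noncomputable def truncExp (l₁ l₂ l₃ l₄ : ℤ) : 𝓞 TauField :=
  1 + l₁ * kappa + (l₂ + 3 * l₁ ^ 2 : ℤ) * kappa ^ 2 + (l₃ + l₁ * l₂ + l₁ ^ 3 : ℤ) * kappa ^ 3 +
    (l₄ + l₁ * l₃ + 3 * l₂ ^ 2 + 3 * l₁ ^ 2 * l₂ + 4 * l₁ ^ 4 : ℤ) * kappa ^ 4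

/-- The element is, modulo `5`, a nonzero scalar times a truncated exponential. -/
def HasLog (η : 𝓞 TauField) (l₁ l₂ l₃ l₄ : ℤ) : Prop :=
  ∃ n : ℤ, ¬ (5 : ℤ) ∣ n ∧ (5 : 𝓞 TauField) ∣ η - n * truncExp l₁ l₂ l₃ l₄

theorem five_dvd_truncExp_mul (l₁ l₂ l₃ l₄ m₁ m₂ m₃ m₄ : ℤ) :
    (5 : 𝓞 TauField) ∣ truncExp l₁ l₂ l₃ l₄ * truncExp m₁ m₂ m₃ m₄ -
      truncExp (l₁ + m₁) (l₂ + m₂) (l₃ + m₃) (l₄ + m₄) := by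
  set A₂ := l₂ + 3 * l₁ ^ 2 with hA₂
  set A₃ := l₃ + l₁ * l₂ + l₁ ^ 3 with hA₃
  set A₄ := l₄ + l₁ * l₃ + 3 * l₂ ^ 2 + 3 * l₁ ^ 2 * l₂ + 4 * l₁ ^ 4 with hA₄
  set B₂ := m₂ + 3 * m₁ ^ 2 with hB₂
  set B₃ := m₃ + m₁ * m₂ + m₁ ^ 3 with hB₃
  set B₄ := m₄ + m₁ * m₃ + 3 * m₂ ^ 2 + 3 * m₁ ^ 2 * m₂ + 4 * m₁ ^ 4 with hB₄
  set P : 𝓞 TauField := (l₁ * B₄ + A₂ * B₃ + A₃ * B₂ + A₄ * m₁) +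
    (A₂ * B₄ + A₃ * B₃ + A₄ * B₂) * kappa + (A₃ * B₄ + A₄ * B₃) * kappa ^ 2 +
    A₄ * B₄ * kappa ^ 3 with hP
  refine ⟨P * (kappa ^ 4 + 2 * kappa ^ 3 - 10 * kappa ^ 2 - 5 * kappa + 17) -
    l₁ * m₁ * kappa ^ 2 - (l₁ * m₁ * m₂ + l₁ * l₂ * m₁ + 3 * l₁ * m₁ ^ 3 + 3 * l₁ ^ 3 * m₁ +
      l₂ * m₂ + 3 * l₁ ^ 2 * m₁ ^ 2) * kappa ^ 4, ?_⟩
  have h := congrArg (P * ·) kappa_fifth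
  simp only [truncExp, hP, hA₂, hA₃, hA₄, hB₂, hB₃, hB₄] at h ⊢
  push_cast at h ⊢
  linear_combination h

theorem HasLog.mul {η ζ : 𝓞 TauField} {l₁ l₂ l₃ l₄ m₁ m₂ m₃ m₄ : ℤ} (hη : HasLog η l₁ l₂ l₃ l₄)
    (hζ : HasLog ζ m₁ m₂ m₃ m₄) :
    HasLog (η * ζ) (l₁ + m₁) (l₂ + m₂) (l₃ + m₃) (l₄ + m₄) := by
  obtain ⟨n, hn, t, ht⟩ := hη
  obtain ⟨k, hk, s, hs⟩ := hζ
  obtain ⟨r, hr⟩ := five_dvd_truncExp_mul l₁ l₂ l₃ l₄ m₁ m₂ m₃ m₄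
  refine ⟨n * k, fun h => ?_, t * ζ + n * truncExp l₁ l₂ l₃ l₄ * s + n * k * r, ?_⟩
  · exact (Int.Prime.dvd_mul' (p := 5) (by norm_num) h).elim hn hk
  · push_cast
    linear_combination ζ * ht + n * truncExp l₁ l₂ l₃ l₄ * hs + n * k * hr

theorem hasLog_intCast {n : ℤ} (hn : ¬ (5 : ℤ) ∣ n) : HasLog n 0 0 0 0 :=
  ⟨n, hn, 0, by simp [truncExp]⟩

theorem HasLog.pow {η : 𝓞 TauField} {l₁ l₂ l₃ l₄ : ℤ} (hη : HasLog η l₁ l₂ l₃ l₄) (k : ℕ) :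
    HasLog (η ^ k) (k * l₁) (k * l₂) (k * l₃) (k * l₄) := by
  induction k with
  | zero => simpa using hasLog_intCast (n := 1) (by norm_num)
  | succ k ih => simpa only [pow_succ, Nat.cast_succ, add_mul, one_mul] using ih.mul hη

theorem HasLog.unique {η : 𝓞 TauField} {l₁ l₂ l₃ l₄ m₁ m₂ m₃ m₄ : ℤ} (hl : HasLog η l₁ l₂ l₃ l₄)
    (hm : HasLog η m₁ m₂ m₃ m₄) : (l₁ : ZMod 5) = m₁ ∧ (l₂ : ZMod 5) = m₂ ∧ (l₃ : ZMod 5) = m₃ ∧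
      (l₄ : ZMod 5) = m₄ := by
  obtain ⟨n, hn, t, ht⟩ := hl
  obtain ⟨k, -, s, hs⟩ := hm
  have h := five_dvd_coeff (a₀ := n - k) (a₁ := n * l₁ - k * m₁)
    (a₂ := n * (l₂ + 3 * l₁ ^ 2) - k * (m₂ + 3 * m₁ ^ 2))
    (a₃ := n * (l₃ + l₁ * l₂ + l₁ ^ 3) - k * (m₃ + m₁ * m₂ + m₁ ^ 3))
    (a₄ := n * (l₄ + l₁ * l₃ + 3 * l₂ ^ 2 + 3 * l₁ ^ 2 * l₂ + 4 * l₁ ^ 4) -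
      k * (m₄ + m₁ * m₃ + 3 * m₂ ^ 2 + 3 * m₁ ^ 2 * m₂ + 4 * m₁ ^ 4))
    ⟨s - t, by
      simp only [truncExp] at ht hs
      push_cast at ht hs ⊢
      linear_combination hs - ht⟩
  have hz : ∀ a : ℤ, (5 : ℤ) ∣ a ↔ (a : ZMod 5) = 0 := fun a =>
    (ZMod.intCast_zmod_eq_zero_iff_dvd a 5).symm
  simp only [hz] at h hn
  push_cast at h
  obtain ⟨h₀, h₁, h₂, h₃, h₄⟩ := h
  rw [← sub_eq_zero.1 h₀, ← mul_sub, mul_eq_zero, or_iff_right hn] at h₁ h₂ h₃ h₄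
  have e₁ := sub_eq_zero.1 h₁
  rw [e₁] at h₂ h₃ h₄
  have e₂ : (l₂ : ZMod 5) = m₂ := by linear_combination h₂
  rw [e₂] at h₃ h₄
  have e₃ : (l₃ : ZMod 5) = m₃ := by linear_combination h₃
  rw [e₃] at h₄
  exact ⟨e₁, e₂, e₃, by linear_combination h₄⟩

theorem hasLog_pow_five {φ : 𝓞 TauField →+* ZMod 5} (hφ : ∀ η, φ η = 0 ↔ piFive ∣ η)
    {η : 𝓞 TauField} (h : φ η ≠ 0) : HasLog (η ^ 5) 0 0 0 0 := by
  obtain ⟨t, ht⟩ : piFive ∣ η - ((φ η).val : ℤ) := by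
    rw [← hφ, map_sub, map_intCast, Int.cast_natCast, ZMod.natCast_zmod_val, sub_self]
  obtain ⟨s, hs⟩ := five_dvd_piFive_pow
  have hη : η = ((φ η).val : ℤ) + piFive * t := by linear_combination ht
  set n : ℤ := ((φ η).val : ℤ) with hn
  have hn5 : ¬ (5 : ℤ) ∣ n := fun h5 => h <| by
    have := (ZMod.intCast_zmod_eq_zero_iff_dvd n 5).2 h5
    rwa [hn, Int.cast_natCast, ZMod.natCast_zmod_val] at this
  refine ⟨n ^ 5, fun h5 => hn5 (Int.Prime.dvd_pow' (p := 5) (by norm_num) h5),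
    s * t ^ 5 + n ^ 4 * (piFive * t) + 2 * n ^ 3 * (piFive * t) ^ 2 +
      2 * n ^ 2 * (piFive * t) ^ 3 + n * (piFive * t) ^ 4, ?_⟩
  rw [hη]
  simp only [truncExp]
  push_cast
  linear_combination t ^ 5 * hs

theorem hasLog_coord (n : ℤ) (hn : ¬ (5 : ℤ) ∣ n) {l₁ l₂ l₃ l₄ : ℤ} (a b c d e a' b' c' d' e' : ℤ)
    (h : coord a b c d e = 5 * coord a' b' c' d' e' + n * truncExp l₁ l₂ l₃ l₄) :
    HasLog (coord a b c d e) l₁ l₂ l₃ l₄ :=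
  ⟨n, hn, coord a' b' c' d' e', by linear_combination h⟩

theorem hasLog_basicUnit_zero : HasLog (basicUnit 0) 4 2 4 3 := by
  refine hasLog_coord 4 (by norm_num) _ _ _ _ _ (-1023) (-3949) (-11496) (-7488) (-3683) ?_
  rw [truncExp, kappa_fourth, kappa_cubed, kappa_sq, kappa]
  simp only [coord]; push_cast; ring

theorem hasLog_basicUnit_one : HasLog (basicUnit 1) 4 2 1 4 := by
  refine hasLog_coord 1 (by norm_num) _ _ _ _ _ (-251) (-978) (-2844) (-1853) (-912) ?_
  rw [truncExp, kappa_fourth, kappa_cubed, kappa_sq, kappa]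
  simp only [coord]; push_cast; ring

theorem hasLog_basicUnit_two : HasLog (basicUnit 2) 0 0 3 4 := by
  refine hasLog_coord 1 (by norm_num) _ _ _ _ _ (-3) (-3) (-14) (-8) (-3) ?_
  rw [truncExp, kappa_fourth, kappa_cubed, kappa_sq, kappa]
  simp only [coord]; push_cast; ring

theorem hasLog_basicUnit_three : HasLog (basicUnit 3) 0 0 0 0 := by
  refine hasLog_coord 4 (by norm_num) _ _ _ _ _ (-29757) 96348 48809 (-39493) (-20240) ?_
  rw [truncExp, kappa_fourth, kappa_cubed, kappa_sq, kappa]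
  simp only [coord]; push_cast; ring

theorem hasLog_piThree : HasLog piThree 4 3 1 3 := by
  refine hasLog_coord 2 (by norm_num) _ _ _ _ _ (-531) (-2058) (-5997) (-3908) (-1923) ?_
  rw [truncExp, kappa_fourth, kappa_cubed, kappa_sq, kappa]
  simp only [coord]; push_cast; ring

theorem hasLog_piEleven : HasLog piEleven 1 1 2 3 := by
  refine hasLog_coord 1 (by norm_num) _ _ _ _ _ (-6) (-13) (-42) (-26) (-12) ?_
  rw [truncExp, kappa_fourth, kappa_cubed, kappa_sq, kappa]
  simp only [coord]; push_cast; ring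

theorem exists_hasLog_linForm {x y : ℤ} (h : ¬ (5 : ℤ) ∣ x - y) :
    ∃ w : ℤ, HasLog (linForm x y) 0 w w (w + 2 * w ^ 2) := by
  obtain ⟨u, v, huv⟩ := prime_int_five.coprime_iff_not_dvd.2 h
  have huv' := congrArg (Int.cast (R := 𝓞 TauField)) huv
  push_cast at huv'
  refine ⟨v * y, x - y, h, coord (15 * y + 3 * u * y) (-3 * y + 9 * u * y) (-12 * y + 20 * u * y)
    (-2 * y + 10 * u * y) (4 * u * y) - (x - y) * (v * y) ^ 2 * kappa ^ 4, ?_⟩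
  rw [truncExp, kappa_fourth, kappa_cubed, kappa_sq, kappa]
  simp only [coord, linForm]
  push_cast
  linear_combination (-(3 + 9 * tau + 20 * sigma + 10 * (tau * sigma) + 4 * sigma ^ 2) * y) * huv'

theorem IsClearing.map_ne_zero {m : ℕ} {w : 𝓞 TauField} (h : IsClearing m w) {p : ℕ}
    [Fact p.Prime] {φ : 𝓞 TauField →+* ZMod p} (h3 : φ piThree ≠ 0) : φ w ≠ 0 := by
  rcases h with ⟨-, rfl⟩ | ⟨-, rfl⟩
  · simp
  · exact h3

theorem IsClearing.cast_ne_zero {m : ℕ} {w : 𝓞 TauField} (h : IsClearing m w) {p : ℕ}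
    [Fact p.Prime] (h3 : (3 : ZMod p) ≠ 0) : (m : ZMod p) ≠ 0 := by
  rcases h with ⟨rfl, -⟩ | ⟨rfl, -⟩
  · simp
  · exact_mod_cast h3

theorem log_system : ∀ a₀ a₁ a₂ z w : ZMod 5, 0 = 4 * a₀ + 4 * a₁ + 16 + z →
    w = 2 * a₀ + 2 * a₁ + 12 + z → w = 4 * a₀ + a₁ + 3 * a₂ + 4 + 2 * z →
    w + 2 * w ^ 2 = 3 * a₀ + 4 * a₁ + 4 * a₂ + 12 + 3 * z → a₀ + a₁ = 2 ∧ z = 1 := by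
  intro a₀ a₁ a₂ z w h₁ h₂
  have h5 : (5 : ZMod 5) = 0 := rfl
  obtain rfl : z = a₀ + a₁ + 4 := by linear_combination -h₁ - (4 + a₀ + a₁) * h5
  subst h₂
  clear h₁ h5
  revert a₀ a₁ a₂
  decide +kernel

theorem condition_at_five {x y : ℤ} {z₂ : ℕ} (hxy : ¬ (5 : ℤ) ∣ x - y) {a : Fin 4 → ZMod 5}
    {v : (𝓞 TauField)ˣ} {m : ℕ} {w : 𝓞 TauField} (hw : IsClearing m w)
    (h : linForm x y * w ^ 5 = m * ((∏ i, (basicUnit i : 𝓞 TauField) ^ (a i).val) * piThree ^ 4 *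
      piFive ^ 0 * piEleven ^ z₂ * (piTwo * v) ^ 5)) :
    a 0 + a 1 = 2 ∧ (z₂ : ZMod 5) = 1 := by
  obtain ⟨φ, hφ, hφ'⟩ := exists_hom_five
  obtain ⟨t, ht⟩ := exists_hasLog_linForm hxy
  have hw0 : φ w ≠ 0 := hw.map_ne_zero (by rw [piThree, hφ']; decide)
  have hm0 : ¬ (5 : ℤ) ∣ m := fun h5 =>
    hw.cast_ne_zero (p := 5) (by decide) <| by
      exact_mod_cast (ZMod.intCast_zmod_eq_zero_iff_dvd m 5).2 h5
  have hv0 : φ (piTwo * v) ≠ 0 := by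
    rw [map_mul]
    exact mul_ne_zero (by rw [piTwo, hφ']; decide) (v.isUnit.map φ).ne_zero
  have h1 := ht.mul (hasLog_pow_five hφ hw0)
  have h2 := (hasLog_intCast hm0).mul (((((((hasLog_basicUnit_zero.pow (a 0).val).mul
    (hasLog_basicUnit_one.pow (a 1).val)).mul (hasLog_basicUnit_two.pow (a 2).val)).mul
    (hasLog_basicUnit_three.pow (a 3).val)).mul (hasLog_piThree.pow 4)).mul
    (hasLog_piEleven.pow z₂)).mul (hasLog_pow_five hφ hv0))
  rw [h, pow_zero, mul_one, Fin.prod_univ_four] at h1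
  obtain ⟨e₁, e₂, e₃, e₄⟩ := h1.unique (by exact_mod_cast h2)
  push_cast [ZMod.natCast_zmod_val] at e₁ e₂ e₃ e₄
  exact log_system (a 0) (a 1) (a 2) z₂ t (by linear_combination e₁) (by linear_combination e₂)
    (by linear_combination e₃) (by linear_combination e₄)

theorem map_linForm {p : ℕ} {φ : 𝓞 TauField →+* ZMod p} {r s : ℤ}
    (hφ : ∀ k l m n q : ℤ,
      φ (coord k l m n q) = ((k + l * r + m * s + n * (r * s) + q * s ^ 2 : ℤ) : ZMod p))
    (x y : ℤ) : φ (linForm x y) = x + (77 - 6 * r - 40 * s + 4 * s ^ 2 : ℤ) * y := by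
  rw [linForm, hφ]
  push_cast
  ring

theorem residue_system : ∀ a₀ a₁ z₁ z₂ : ZMod 5,
    (1 : ZMod 11) ^ a₀.val * 1 ^ a₁.val * 1 * 4 ^ z₁.val * 9 ^ z₂.val =
      9 ^ a₀.val * 3 ^ a₁.val * 9 ^ 4 * 9 ^ z₁.val * 3 ^ z₂.val →
    2 * a₀ + a₁ + 3 = 2 * z₁ + z₂ := by
  decide +kernel

theorem pow_val_natCast {M : Type*} [Monoid M] {b : M} {n : ℕ} (h : b ^ n = 1) (k : ℕ) :
    b ^ (k : ZMod n).val = b ^ k := by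
  rw [ZMod.val_natCast, ← pow_eq_pow_mod k h]

/-- The factorization of a linear form, raised to a power and read in a residue field. -/
theorem map_linForm_pow {x y : ℤ} {z₁ z₂ : ℕ} {a : Fin 4 → ZMod 5}
    {v : (𝓞 TauField)ˣ} {m : ℕ} {w : 𝓞 TauField} (hw : IsClearing m w)
    (h : linForm x y * w ^ 5 = m * ((∏ i, (basicUnit i : 𝓞 TauField) ^ (a i).val) * piThree ^ 4 *
      piFive ^ z₁ * piEleven ^ z₂ * (piTwo * v) ^ 5))
    {p : ℕ} [Fact p.Prime] {φ : 𝓞 TauField →+* ZMod p} {k : ℕ} (hk : 5 * k = p - 1)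
    (h2 : φ piTwo ≠ 0) (h3 : φ piThree ≠ 0) :
    φ (linForm x y) ^ k = (m : ZMod p) ^ k * ((φ (basicUnit 0) ^ k) ^ (a 0).val *
      (φ (basicUnit 1) ^ k) ^ (a 1).val * (φ (basicUnit 2) ^ k) ^ (a 2).val *
      (φ (basicUnit 3) ^ k) ^ (a 3).val * (φ piThree ^ k) ^ 4 * (φ piFive ^ k) ^ z₁ *
      (φ piEleven ^ k) ^ z₂) := by
  have key : ∀ {c : ZMod p}, c ≠ 0 → (c ^ 5) ^ k = 1 := fun hc => by
    rw [← pow_mul, hk, ZMod.pow_card_sub_one_eq_one hc]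
  have := congrArg (fun η => φ η ^ k) h
  simp only [map_mul, map_pow, mul_pow, map_natCast, Fin.prod_univ_four,
    key (hw.map_ne_zero h3), key h2, key (v.isUnit.map φ).ne_zero, mul_one] at this
  rw [this]
  simp only [← pow_mul, mul_comm]

theorem condition_at_eleven {x y : ℤ} {z₁ z₂ : ℕ} {a : Fin 4 → ZMod 5}
    {v : (𝓞 TauField)ˣ} {m : ℕ} {w : 𝓞 TauField} (hw : IsClearing m w)
    (h : linForm x y * w ^ 5 = m * ((∏ i, (basicUnit i : 𝓞 TauField) ^ (a i).val) * piThree ^ 4 *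
      piFive ^ z₁ * piEleven ^ z₂ * (piTwo * v) ^ 5)) :
    2 * a 0 + a 1 + 3 = 2 * (z₁ : ZMod 5) + z₂ := by
  obtain ⟨φ, -, hφ⟩ := exists_hom_ramFive
  obtain ⟨ψ, -, hψ⟩ := exists_hom_ramEight
  have e₁ := map_linForm_pow hw h (φ := φ) (k := 2) rfl (by rw [piTwo, hφ]; decide)
    (by rw [piThree, hφ]; decide)
  have e₂ := map_linForm_pow hw h (φ := ψ) (k := 2) rfl (by rw [piTwo, hψ]; decide)
    (by rw [piThree, hψ]; decide)
  have e₃ : φ (linForm x y) = ψ (linForm x y) := by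
    rw [map_linForm hφ, map_linForm hψ]
    congr 2
  rw [← e₃, e₁] at e₂
  have hm := pow_ne_zero 2 (hw.cast_ne_zero (p := 11) (by decide))
  replace e₂ := mul_left_cancel₀ hm e₂
  simp only [map_basicUnit_ramFive hφ, map_basicUnit_ramEight hψ, Matrix.cons_val] at e₂
  rw [show φ piThree ^ 2 = 1 by rw [piThree, hφ]; decide,
    show φ piFive ^ 2 = 4 by rw [piFive, hφ]; decide,
    show φ piEleven ^ 2 = 9 by rw [piEleven, hφ]; decide,
    show ψ piThree ^ 2 = 9 by rw [piThree, hψ]; decide,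
    show ψ piFive ^ 2 = 9 by rw [piFive, hψ]; decide,
    show ψ piEleven ^ 2 = 3 by rw [piEleven, hψ]; decide] at e₂
  have h3 : (3 : ZMod 11) ^ 5 = 1 := by decide
  have h4 : (4 : ZMod 11) ^ 5 = 1 := by decide
  have h9 : (9 : ZMod 11) ^ 5 = 1 := by decide
  refine residue_system (a 0) (a 1) z₁ z₂ ?_
  rw [pow_val_natCast h4, pow_val_natCast h9, pow_val_natCast h9, pow_val_natCast h3]
  have hne : (3 : ZMod 11) ^ (a 2).val * 4 ^ (a 3).val ≠ 0 :=
    mul_ne_zero (pow_ne_zero _ (by decide)) (pow_ne_zero _ (by decide))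
  refine mul_left_cancel₀ hne ?_
  rw [one_pow] at e₂
  linear_combination e₂

/-- The images of `θ` in the residue fields above `181`. -/
def thetaMod : Fin 5 → ZMod 181 := ![144, 147, 39, 6, 142]

/-- The part of the thirty-sixth power of the linear form, in the residue fields above `181`, that
depends on the residue field. -/
def residueFactor (a₀ a₁ z₁ z₂ : ℕ) (i : Fin 5) : ZMod 181 :=
  unitTable i 0 ^ a₀ * unitTable i 1 ^ a₁ * (![1, 135, 42, 125, 42] : Fin 5 → ZMod 181) i ^ 4 *
    (![59, 135, 125, 135, 135] : Fin 5 → ZMod 181) i ^ z₁ *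
    (![1, 1, 59, 125, 125] : Fin 5 → ZMod 181) i ^ z₂

/-- The exponents left by the conditions at `5` and `11`. -/
def admissible : Finset (ℕ × ℕ × ℕ × ℕ) :=
  {(1, 1, 0, 1), (0, 4, 2, 3), (1, 2, 2, 3), (2, 0, 2, 3), (3, 3, 2, 3), (4, 1, 2, 3)}

theorem exists_residueFactor_ne : ∀ e ∈ admissible, ∃ i,
    residueFactor e.1 e.2.1 e.2.2.1 e.2.2.2 i ≠ residueFactor e.1 e.2.1 e.2.2.1 e.2.2.2 0 := by
  decide +kernel

theorem exists_residue_ne : ∀ t : ZMod 181, ∀ e ∈ admissible, ∃ i,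
    (t - thetaMod i) ^ 36 * residueFactor e.1 e.2.1 e.2.2.1 e.2.2.2 0 ≠
      (t - thetaMod 0) ^ 36 * residueFactor e.1 e.2.1 e.2.2.1 e.2.2.2 i := by
  decide +kernel

theorem not_admissible {x y : ℤ} {z₁ z₂ : ℕ} {a : Fin 4 → ZMod 5}
    {v : (𝓞 TauField)ˣ} {m : ℕ} {w : 𝓞 TauField} (hw : IsClearing m w)
    (h : linForm x y * w ^ 5 = m * ((∏ i, (basicUnit i : 𝓞 TauField) ^ (a i).val) * piThree ^ 4 *
      piFive ^ z₁ * piEleven ^ z₂ * (piTwo * v) ^ 5)) :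
    ((a 0).val, (a 1).val, z₁, z₂ % 5) ∉ admissible := by
  intro hadm
  set K := residueFactor (a 0).val (a 1).val z₁ (z₂ % 5) with hK
  set c : ZMod 181 := (m : ZMod 181) ^ 36 * (125 ^ (a 2).val * 59 ^ (a 3).val) with hc
  have hc0 : c ≠ 0 := mul_ne_zero (pow_ne_zero _ (hw.cast_ne_zero (by decide)))
    (mul_ne_zero (pow_ne_zero _ (by decide)) (pow_ne_zero _ (by decide)))
  have key : ∀ i, ((x : ZMod 181) - thetaMod i * y) ^ 36 = c * K i := fun i => by
    obtain ⟨φ, hφ⟩ := exists_hom_evalMod i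
    have hfacts : (evalMod i 2 (-7) 7 1 (-1) : ZMod 181) ≠ 0 ∧
        (evalMod i 15 0 (-9) 0 1 : ZMod 181) ≠ 0 ∧
        (evalMod i 15 0 (-9) 0 1 : ZMod 181) ^ 36 =
          (![1, 135, 42, 125, 42] : Fin 5 → ZMod 181) i ∧
        (evalMod i 17 (-1) (-9) 0 1 : ZMod 181) ^ 36 =
          (![59, 135, 125, 135, 135] : Fin 5 → ZMod 181) i ∧
        (evalMod i (-5) 16 2 (-2) 0 : ZMod 181) ^ 36 =
          (![1, 1, 59, 125, 125] : Fin 5 → ZMod 181) i ∧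
        ((![1, 1, 59, 125, 125] : Fin 5 → ZMod 181) i) ^ 5 = 1 ∧
        unitTable i 2 = 125 ∧ unitTable i 3 = 59 ∧
        ((77 - 6 * rootMod i - 40 * (91 * rootMod i ^ 2) + 4 * (91 * rootMod i ^ 2) ^ 2 : ℤ) :
          ZMod 181) = -thetaMod i := by
      clear hφ
      revert i
      decide +kernel
    obtain ⟨f₂, f₃, p₃, p₅, p₁₁, o₁₁, u₂, u₃, hθ⟩ := hfacts
    have := map_linForm_pow hw h (φ := φ) (k := 36) rfl (by rwa [piTwo, hφ])
      (by rwa [piThree, hφ])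
    rw [map_linForm (r := rootMod i) (s := 91 * rootMod i ^ 2) hφ, hθ] at this
    simp only [map_basicUnit_pow hφ, u₂, u₃] at this
    rw [piThree, piFive, piEleven, hφ, hφ, hφ, p₃, p₅, p₁₁, pow_eq_pow_mod z₂ o₁₁] at this
    rw [neg_mul, ← sub_eq_add_neg] at this
    rw [this, hK, residueFactor, hc]
    ring
  by_cases hy : (y : ZMod 181) = 0
  · simp only [hy, mul_zero, sub_zero] at key
    obtain ⟨i, hi⟩ := exists_residueFactor_ne _ hadm
    exact hi (mul_left_cancel₀ hc0 ((key i).symm.trans (key 0)))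
  · obtain ⟨i, hi⟩ := exists_residue_ne (x / y) _ hadm
    have hscale : ∀ j, ((x : ZMod 181) / y - thetaMod j) ^ 36 * y ^ 36 = c * K j := fun j => by
      rw [← mul_pow, sub_mul, div_mul_cancel₀ _ hy, key]
    refine hi (mul_right_cancel₀ (pow_ne_zero 36 hy) ?_)
    linear_combination K 0 * hscale i - K i * hscale 0

theorem le_and_eq_of_pow_mul {p r g : ℤ} (hp : Prime p) (hr : ¬ p ∣ r) {k z : ℕ}
    (h : p ^ k * g = -(r * p ^ z)) : k ≤ z ∧ g = -(r * p ^ (z - k)) := by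
  have hk : k ≤ z := by
    by_contra! hlt
    obtain ⟨d, rfl⟩ := Nat.exists_eq_add_of_lt hlt
    refine hr ⟨-(p ^ d * g), mul_left_cancel₀ (pow_ne_zero z hp.ne_zero) ?_⟩
    linear_combination h
  refine ⟨hk, mul_left_cancel₀ (pow_ne_zero k hp.ne_zero) ?_⟩
  obtain ⟨d, rfl⟩ := Nat.exists_eq_add_of_le hk
  rw [h, Nat.add_sub_cancel_left]
  ring

theorem eq_and_eq_of_pow_mul {p r g : ℤ} (hp : Prime p) (hr : ¬ p ∣ r) (hg : ¬ p ∣ g) {k z : ℕ}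
    (h : p ^ k * g = -(r * p ^ z)) : z = k ∧ g = -r := by
  obtain ⟨hk, e⟩ := le_and_eq_of_pow_mul hp hr h
  rcases hk.eq_or_lt with rfl | hlt
  · simpa using e
  · refine absurd ?_ hg
    rw [e, dvd_neg]
    exact (dvd_pow_self p (by omega)).mul_left r

theorem prime_int_eleven : Prime (11 : ℤ) := Int.prime_iff_natAbs_prime.2 (by norm_num)

theorem not_five_dvd (z : ℕ) : ¬ (5 : ℤ) ∣ 2592 * 11 ^ z := fun h =>
  (prime_int_five.dvd_or_dvd h).elim (by norm_num)
    fun h => absurd (prime_int_five.dvd_of_dvd_pow h) (by norm_num)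

theorem not_eleven_dvd (z : ℕ) : ¬ (11 : ℤ) ∣ 2592 * 5 ^ z := fun h =>
  (prime_int_eleven.dvd_or_dvd h).elim (by norm_num)
    fun h => absurd (prime_int_eleven.dvd_of_dvd_pow h) (by norm_num)

/-- The quintic form. -/
def quinticForm (x y : ℤ) : ℤ :=
  x ^ 5 + 65 * x ^ 4 * y - 870 * x ^ 3 * y ^ 2 - 18990 * x ^ 2 * y ^ 3 +
    26325 * x * y ^ 4 + 255069 * y ^ 5

theorem quinticForm_mul (t x y : ℤ) : quinticForm (t * x) (t * y) = t ^ 5 * quinticForm x y := by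
  unfold quinticForm; ring

theorem exponents_of_five {x y : ℤ} {z₁ z₂ : ℕ} (hxy : ¬ ((5 : ℤ) ∣ x ∧ (5 : ℤ) ∣ y))
    (h : quinticForm x y = -(2592 * 5 ^ z₁ * 11 ^ z₂)) :
    (z₁ = 0 ∧ ¬ (5 : ℤ) ∣ x - y) ∨ (z₁ = 2 ∧ z₂ % 5 = 3) := by
  by_cases hd : (5 : ℤ) ∣ x - y
  · right
    obtain ⟨s, hs⟩ := hd
    obtain rfl : x = y + 5 * s := by linear_combination hs
    have hy : ¬ (5 : ℤ) ∣ y := fun hy => hxy ⟨dvd_add hy (dvd_mul_right _ _), hy⟩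
    have hG : ¬ (5 : ℤ) ∣ 10464 * y ^ 5 - 2800 * s * y ^ 4 - 21200 * s ^ 2 * y ^ 3 -
        3000 * s ^ 3 * y ^ 2 + 1750 * s ^ 4 * y + 125 * s ^ 5 := fun ⟨t, ht⟩ => by
      refine (prime_int_five.dvd_or_dvd (a := 10464) (b := y ^ 5) ⟨t + 560 * s * y ^ 4 +
        4240 * s ^ 2 * y ^ 3 + 600 * s ^ 3 * y ^ 2 - 350 * s ^ 4 * y - 25 * s ^ 5, ?_⟩).elim
        (by norm_num) fun h => hy (prime_int_five.dvd_of_dvd_pow h)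
      linear_combination ht
    obtain ⟨rfl, e⟩ := eq_and_eq_of_pow_mul prime_int_five (not_five_dvd z₂) hG (k := 2) (z := z₁)
      (by unfold quinticForm at h; linear_combination h)
    refine ⟨rfl, ?_⟩
    have e' := congrArg (Int.cast (R := ZMod 25)) e
    push_cast at e'
    have h25 : (25 : ZMod 25) = 0 := rfl
    have e₂ : (14 : ZMod 25) * y ^ 5 = 8 * 11 ^ (z₂ % 5) := by
      rw [← pow_eq_pow_mod z₂ (show (11 : ZMod 25) ^ 5 = 1 by decide)]
      linear_combination e' + (-104 * 11 ^ z₂ - 418 * y ^ 5 + 112 * s * y ^ 4 +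
        848 * s ^ 2 * y ^ 3 + 120 * s ^ 3 * y ^ 2 - 70 * s ^ 4 * y - 5 * s ^ 5) * h25
    have := Nat.mod_lt z₂ (show 0 < 5 by norm_num)
    have key : ∀ (u : ZMod 25) (k : Fin 5), 14 * u ^ 5 = 8 * 11 ^ k.val → k.val = 3 := by
      decide +kernel
    exact key y ⟨z₂ % 5, this⟩ e₂
  · left
    refine ⟨?_, hd⟩
    by_contra hz
    obtain ⟨k, rfl⟩ := Nat.exists_eq_succ_of_ne_zero hz
    have e' := congrArg (Int.cast (R := ZMod 5)) h
    unfold quinticForm at e'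
    push_cast [Nat.succ_eq_add_one, pow_succ (5 : ZMod 5) k] at e'
    have h5 : (5 : ZMod 5) = 0 := rfl
    have key : ∀ u w : ZMod 5, u ^ 5 - w ^ 5 = 0 → u = w := by decide
    refine hd ((ZMod.intCast_zmod_eq_zero_iff_dvd _ 5).1 ?_)
    rw [Int.cast_sub, sub_eq_zero]
    refine key _ _ ?_
    linear_combination e' - (13 * x ^ 4 * y - 174 * x ^ 3 * y ^ 2 - 3798 * x ^ 2 * y ^ 3 +
      5265 * x * y ^ 4 + 51014 * y ^ 5 + 2592 * 5 ^ k * 11 ^ z₂) * h5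

theorem not_eleven_dvd_of_eq {x y : ℤ} {z₁ z₂ : ℕ} (hxy : ¬ ((11 : ℤ) ∣ x ∧ (11 : ℤ) ∣ y))
    (hz : z₁ = 0 ∨ (z₁ = 2 ∧ z₂ % 5 = 3))
    (h : quinticForm x y = -(2592 * 5 ^ z₁ * 11 ^ z₂)) : ¬ (11 : ℤ) ∣ x + 7 * y := by
  rintro ⟨t, ht⟩
  obtain ⟨s, rfl⟩ : ∃ s, x = 4 * y + 11 * s := ⟨t - y, by linear_combination ht⟩
  have hy : ¬ (11 : ℤ) ∣ y := fun hy => hxy ⟨dvd_add (hy.mul_left 4) (dvd_mul_right _ _), hy⟩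
  have hH : ¬ (11 : ℤ) ∣ 153 * y ^ 5 - 13585 * s * y ^ 4 - 22550 * s ^ 2 * y ^ 3 +
      3630 * s ^ 3 * y ^ 2 + 10285 * s ^ 4 * y + 1331 * s ^ 5 := fun ⟨t, ht⟩ => by
    refine (prime_int_eleven.dvd_or_dvd (a := 153) (b := y ^ 5) ⟨t + 1235 * s * y ^ 4 +
      2050 * s ^ 2 * y ^ 3 - 330 * s ^ 3 * y ^ 2 - 935 * s ^ 4 * y - 121 * s ^ 5, ?_⟩).elim
      (by norm_num) fun h => hy (prime_int_eleven.dvd_of_dvd_pow h)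
    linear_combination ht
  obtain ⟨rfl, e⟩ := eq_and_eq_of_pow_mul prime_int_eleven (not_eleven_dvd z₁) hH (k := 2)
    (z := z₂) (by unfold quinticForm at h; linear_combination h)
  obtain rfl : z₁ = 0 := hz.resolve_right fun h => absurd h.2 (by norm_num)
  have e' := congrArg (Int.cast (R := ZMod 11)) e
  push_cast at e'
  have h11 : (11 : ZMod 11) = 0 := rfl
  have key : ∀ u : ZMod 11, u ^ 5 + 4 ≠ 0 := by decide
  refine key y ?_
  linear_combination -e' + (14 * y ^ 5 - 1235 * s * y ^ 4 - 2050 * s ^ 2 * y ^ 3 +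
    330 * s ^ 3 * y ^ 2 + 935 * s ^ 4 * y + 121 * s ^ 5 + 236) * h11

theorem quinticForm_ne_of_primitive {x y : ℤ} {z₁ z₂ : ℕ} (h5 : ¬ ((5 : ℤ) ∣ x ∧ (5 : ℤ) ∣ y))
    (h11 : ¬ ((11 : ℤ) ∣ x ∧ (11 : ℤ) ∣ y)) :
    quinticForm x y ≠ -(2592 * 5 ^ z₁ * 11 ^ z₂) := fun h => by
  have hz := exponents_of_five h5 h
  have hram := not_eleven_dvd_of_eq h11 (hz.imp_left And.left) h
  obtain ⟨a, v, m, w, hw, hfac⟩ := exists_linForm_eq (z₁ := z₁) (z₂ := z₂) hram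
    (by unfold quinticForm at h; rw [h]; norm_num)
  have c11 := condition_at_eleven hw hfac
  refine not_admissible hw hfac ?_
  rcases hz with ⟨rfl, hd⟩ | ⟨rfl, hz2⟩
  · obtain ⟨c5, hz1⟩ := condition_at_five hd hw hfac
    have hmod : z₂ % 5 = 1 := by
      have := congrArg ZMod.val hz1
      rwa [ZMod.val_natCast] at this
    rw [hz1] at c11
    rw [hmod]
    generalize a 0 = b, a 1 = c at *
    clear * - c5 c11
    revert b c
    decide +kernel
  · have hcast : (z₂ : ZMod 5) = 3 := by
      rw [← ZMod.natCast_mod, hz2]; rfl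
    rw [hcast] at c11
    rw [hz2]
    generalize a 0 = b, a 1 = c at *
    clear * - c11
    revert b c
    decide +kernel

theorem quinticForm_ne (n : ℕ) : ∀ (x y : ℤ) (z₁ z₂ : ℕ), z₁ + z₂ = n →
    quinticForm x y ≠ -(2592 * 5 ^ z₁ * 11 ^ z₂) := by
  induction n using Nat.strong_induction_on with
  | _ n ih =>
    intro x y z₁ z₂ hn h
    by_cases h5 : (5 : ℤ) ∣ x ∧ (5 : ℤ) ∣ y
    · obtain ⟨⟨x, rfl⟩, ⟨y, rfl⟩⟩ := h5
      rw [quinticForm_mul] at h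
      obtain ⟨hk, e⟩ := le_and_eq_of_pow_mul prime_int_five (not_five_dvd z₂) (k := 5) (z := z₁)
        (by rw [h]; ring)
      exact ih (z₁ - 5 + z₂) (by omega) x y _ _ rfl (by rw [e]; ring)
    by_cases h11 : (11 : ℤ) ∣ x ∧ (11 : ℤ) ∣ y
    · obtain ⟨⟨x, rfl⟩, ⟨y, rfl⟩⟩ := h11
      rw [quinticForm_mul] at h
      obtain ⟨hk, e⟩ := le_and_eq_of_pow_mul prime_int_eleven (not_eleven_dvd z₁) (k := 5)
        (z := z₂) (by rw [h])
      exact ih (z₁ + (z₂ - 5)) (by omega) x y _ _ rfl e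
    exact quinticForm_ne_of_primitive h5 h11 h

theorem no_thue_mahler_solutions :
    ¬ ∃ (x y : ℤ) (z1 z2 : ℕ),
      x ^ 5 + 65 * x ^ 4 * y - 870 * x ^ 3 * y ^ 2 - 18990 * x ^ 2 * y ^ 3 +
        26325 * x * y ^ 4 + 255069 * y ^ 5 =
      -(2 ^ 5 * 3 ^ 4 * 5 ^ z1 * 11 ^ z2) := by
  rintro ⟨x, y, z₁, z₂, h⟩
  exact quinticForm_ne _ x y z₁ z₂ rfl (h.trans (by norm_num))
end

section
/- The Thue equation x^5 + 65·x^4·y − 870·x^3·y^2 − 18990·x^2·y^3 + 26325·x·y^4 + 255069·y^5 = −2^5·3^4·11 has no integer solutions (x, y). -/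
open NumberField Polynomial

/-- The element `c₀ + c₁ w + c₂ w² + c₃ v + c₄ w v`. -/
def basisCombination {R : Type*} [CommRing R] (v w : R) (c : Fin 5 → ℤ) : R :=
  c 0 + c 1 * w + c 2 * w ^ 2 + c 3 * v + c 4 * (w * v)

theorem map_basisCombination {R S : Type*} [CommRing R] [CommRing S] (g : R →+* S) (v w : R)
    (c : Fin 5 → ℤ) : g (basisCombination v w c) = basisCombination (g v) (g w) c := by
  simp [basisCombination]

/-- The relations of the integral basis `1, w, w², v, w v`. -/
structure BasisRelations {R : Type*} [CommRing R] (v w : R) : Prop where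
  sq_eq : v ^ 2 = 8 - 2 * w
  cube_eq : w ^ 3 = 2 * w ^ 2 + 12 * w - 3 * v - 16
  mul_sq_eq : v * w ^ 2 = 6 + 4 * v - 2 * w * v

theorem BasisRelations.mul_eq_one {R : Type*} [CommRing R] {v w : R} (h : BasisRelations v w)
    (c d : Fin 5 → ℤ)
    (h₀ : c 0 * d 0 - 16 * (c 1 * d 2 + c 2 * d 1) - 32 * (c 2 * d 2) + 8 * (c 3 * d 3) +
      32 * (c 4 * d 4) + 6 * (c 1 * d 4 + c 4 * d 1 + c 2 * d 3 + c 3 * d 2) -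
      12 * (c 2 * d 4 + c 4 * d 2) = 1)
    (h₁ : c 0 * d 1 + c 1 * d 0 + 12 * (c 1 * d 2 + c 2 * d 1) + 8 * (c 2 * d 2) -
      2 * (c 3 * d 3) + 8 * (c 3 * d 4 + c 4 * d 3) - 24 * (c 4 * d 4) +
      6 * (c 2 * d 4 + c 4 * d 2) = 0)
    (h₂ : c 0 * d 2 + c 2 * d 0 + c 1 * d 1 + 2 * (c 1 * d 2 + c 2 * d 1) + 16 * (c 2 * d 2) -
      2 * (c 3 * d 4 + c 4 * d 3) + 4 * (c 4 * d 4) = 0)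
    (h₃ : c 0 * d 3 + c 3 * d 0 - 3 * (c 1 * d 2 + c 2 * d 1) - 6 * (c 2 * d 2) +
      6 * (c 4 * d 4) + 4 * (c 1 * d 4 + c 4 * d 1 + c 2 * d 3 + c 3 * d 2) -
      8 * (c 2 * d 4 + c 4 * d 2) = 0)
    (h₄ : c 0 * d 4 + c 4 * d 0 + c 1 * d 3 + c 3 * d 1 - 3 * (c 2 * d 2) -
      2 * (c 1 * d 4 + c 4 * d 1 + c 2 * d 3 + c 3 * d 2) + 8 * (c 2 * d 4 + c 4 * d 2) = 0) :
    basisCombination v w c * basisCombination v w d = 1 := by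
  have e₀ := congrArg (Int.cast (R := R)) h₀
  have e₁ := congrArg (Int.cast (R := R)) h₁
  have e₂ := congrArg (Int.cast (R := R)) h₂
  have e₃ := congrArg (Int.cast (R := R)) h₃
  have e₄ := congrArg (Int.cast (R := R)) h₄
  push_cast at e₀ e₁ e₂ e₃ e₄
  simp only [basisCombination]
  linear_combination e₀ + w * e₁ + w ^ 2 * e₂ + v * e₃ + w * v * e₄ +
    (c 3 * d 3 + (c 3 * d 4 + c 4 * d 3) * w + c 4 * d 4 * w ^ 2) * h.sq_eq +
    (c 1 * d 2 + c 2 * d 1 + c 2 * d 2 * (w + 2) - 2 * (c 4 * d 4)) * h.cube_eq +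
    (c 1 * d 4 + c 4 * d 1 + c 2 * d 3 + c 3 * d 2 + (c 2 * d 4 + c 4 * d 2) * (w - 2)) *
      h.mul_sq_eq

/-- Coordinates of four independent units. -/
def unitCoords : Fin 4 → Fin 5 → ℤ :=
  ![![1, 0, 0, 1, -1], ![-3, 0, 1, -1, 0], ![5, -3, 0, 2, -1], ![-7, 6, -1, -3, 2]]

/-- Coordinates of the inverses of the units with coordinates `unitCoords`. -/
def unitInvCoords : Fin 4 → Fin 5 → ℤ :=
  ![![5, 2, 0, -3, -1], ![605, 64, -47, -161, -61], ![-309, -5, 25, -99, -26],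
    ![13, -34, 7, -11, 13]]

theorem BasisRelations.unit_mul_inv {R : Type*} [CommRing R] {v w : R} (h : BasisRelations v w)
    (i : Fin 4) :
    basisCombination v w (unitCoords i) * basisCombination v w (unitInvCoords i) = 1 := by
  apply h.mul_eq_one <;> revert i <;> decide

/-- The unit with coordinates `unitCoords i`. -/
def BasisRelations.unit {R : Type*} [CommRing R] {v w : R} (h : BasisRelations v w) (i : Fin 4) :
    Rˣ :=
  Units.mkOfMulEqOne _ _ (h.unit_mul_inv i)

theorem pow_map_unit_eq {R : Type*} [CommRing R] {q : ℕ} [Fact q.Prime] {m : ℕ}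
    (hm : 12 * m = q - 1) {ζ : ZMod q} (hζ : (-1) ^ m = ζ ^ 6) (g : R →+* ZMod q)
    {ε : Fin 4 → Rˣ} {L : Fin 4 → ℕ} (hL : ∀ i, g (ε i) ^ m = ζ ^ L i)
    (s : ℕ) (e : Fin 4 → ℕ) (η : Rˣ) :
    g ((-1) ^ s * (∏ i, ε i ^ e i) * η ^ 12 : Rˣ) ^ m = ζ ^ (6 * s + ∑ i, L i * e i) := by
  have hη : (g η ^ 12) ^ m = 1 := by
    rw [← pow_mul, hm]
    exact ZMod.pow_card_sub_one_eq_one ((Units.isUnit η).map g).ne_zero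
  simp only [Units.val_mul, Units.val_pow_eq_pow_val, Units.val_neg, Units.val_one,
    Units.coe_prod, map_mul, map_pow, map_prod, map_neg, map_one, mul_pow, hη, mul_one]
  rw [← pow_mul, mul_comm s, pow_mul, hζ, ← pow_mul, pow_add, ← Finset.prod_pow,
    ← Finset.prod_pow_eq_pow_sum]
  congr 1
  refine Finset.prod_congr rfl fun i _ => ?_
  rw [← pow_mul, mul_comm, pow_mul, hL, ← pow_mul]

theorem BasisRelations.map_right {q : ℕ} [Fact q.Prime] {R : Type*} [CommRing R] {v w : R}
    (h : BasisRelations v w) (g : R →+* ZMod q) {r s : ZMod q} (h2 : (2 : ZMod q) ≠ 0)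
    (hr : g v = r) (hs : r ^ 2 = 8 - 2 * s) : g w = s := by
  have := congrArg g h.sq_eq
  simp only [map_pow, map_sub, map_mul, map_ofNat, hr, hs] at this
  exact mul_left_cancel₀ h2 (by linear_combination this)

/-- In a number field of odd degree the unit group modulo `n`-th powers is finite, and Dirichlet's
unit theorem bounds its order. -/
theorem card_units_quotient_pow_le (K : Type*) [Field K] [NumberField K]
    (hK : Odd (Module.finrank ℚ K)) (n : ℕ) (hn : 0 < n) :
    Finite ((𝓞 K)ˣ ⧸ (powMonoidHom n : (𝓞 K)ˣ →* (𝓞 K)ˣ).range) ∧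
    Nat.card ((𝓞 K)ˣ ⧸ (powMonoidHom n : (𝓞 K)ˣ →* (𝓞 K)ˣ).range) ≤
      2 * n ^ (Module.finrank ℚ K - 1) := by
  have : NeZero n := ⟨hn.ne'⟩
  let s : Units.torsion K × (Fin (Units.rank K) → Fin n) →
      (𝓞 K)ˣ ⧸ (powMonoidHom n : (𝓞 K)ˣ →* (𝓞 K)ˣ).range :=
    fun t => QuotientGroup.mk ((t.1 : (𝓞 K)ˣ) * ∏ i, Units.fundSystem K i ^ (t.2 i : ℕ))
  have hs : Function.Surjective s := by
    intro c
    obtain ⟨u, rfl⟩ := QuotientGroup.mk_surjective c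
    obtain ⟨⟨ζ, e⟩, hu, -⟩ := Units.exist_unique_eq_mul_prod K u
    have hn' : (0 : ℤ) < n := by exact_mod_cast hn
    refine ⟨⟨ζ, fun i => ⟨(e i % n).toNat, by
      have := Int.emod_nonneg (e i) hn'.ne'
      have := Int.emod_lt_of_pos (e i) hn'
      omega⟩⟩, ?_⟩
    refine QuotientGroup.eq.2 ⟨∏ i, Units.fundSystem K i ^ (e i / n), ?_⟩
    simp only [powMonoidHom_apply]
    rw [eq_inv_mul_iff_mul_eq, hu, mul_assoc, ← Finset.prod_pow, ← Finset.prod_mul_distrib]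
    congr 1
    refine Finset.prod_congr rfl fun i _ => ?_
    rw [← zpow_natCast, ← zpow_natCast, ← zpow_mul, ← zpow_add,
      Int.toNat_of_nonneg (Int.emod_nonneg _ hn'.ne'), mul_comm, Int.emod_add_mul_ediv]
  have hr : Units.rank K ≤ Module.finrank ℚ K - 1 := by
    have h₁ := InfinitePlace.card_add_two_mul_card_eq_rank K
    have h₂ := InfinitePlace.card_eq_nrRealPlaces_add_nrComplexPlaces K
    unfold Units.rank
    omega
  refine ⟨Finite.of_surjective s hs, (Nat.card_le_card_of_surjective s hs).trans ?_⟩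
  have ht := Units.torsionOrder_eq_two_of_odd_finrank hK
  rw [Units.torsionOrder] at ht
  rw [Nat.card_prod, ht, Nat.card_eq_fintype_card, Fintype.card_fun, Fintype.card_fin,
    Fintype.card_fin]
  exact Nat.mul_le_mul_left 2 (Nat.pow_le_pow_right hn hr)

/-- A simple root modulo `p` of a polynomial with root `θ` lifts, by Hensel's lemma, to `ℤ_[p]`, and
so defines a place of `K` above `p` at which `θ` takes the value of that root. -/
theorem exists_ringOfIntegers_hom_zmod {f : ℤ[X]} {K : Type*} [Field K] [NumberField K]
    {θ : 𝓞 K} (φ : ∀ {S : Type} [Field S] [CharZero S] (s : S), aeval s f = 0 →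
      ∃ g : K →+* S, g θ = s)
    (p : ℕ) [Fact p.Prime] (r : ℤ) (hr : (p : ℤ) ∣ f.eval r)
    (hr' : ¬ (p : ℤ) ∣ f.derivative.eval r) :
    ∃ g : 𝓞 K →+* ZMod p, g θ = r := by
  have hnorm : ‖aeval (r : ℤ_[p]) f‖ < ‖aeval (r : ℤ_[p]) (derivative f)‖ ^ 2 := by
    have e : ∀ F : ℤ[X], aeval (r : ℤ_[p]) F = ((F.eval r : ℤ) : ℤ_[p]) := fun F => by
      simpa using aeval_algebraMap_apply ℤ_[p] r F
    rw [e, e]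
    have h1 := (PadicInt.norm_int_lt_one_iff_dvd (p := p) _).2 hr
    have h2 : ‖((f.derivative.eval r : ℤ) : ℤ_[p])‖ = 1 :=
      le_antisymm (PadicInt.norm_le_one _)
        (not_lt.1 fun h => hr' ((PadicInt.norm_int_lt_one_iff_dvd _).1 h))
    rw [h2]; simpa using h1
  obtain ⟨z, hz, hzr, -, -⟩ := hensels_lemma hnorm
  obtain ⟨g, hg⟩ := φ (z : ℚ_[p]) (by
    have := aeval_algebraMap_apply ℚ_[p] z f
    rw [hz, map_zero] at this
    simpa using this)
  have hint : ∀ x : 𝓞 K, (g.comp (algebraMap (𝓞 K) K)) x ∈ PadicInt.subring p := fun x => by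
    have h1 : IsIntegral ℤ (g (algebraMap (𝓞 K) K x)) :=
      (RingOfIntegers.isIntegral_coe x).map g.toIntAlgHom
    obtain ⟨y, hy⟩ := IsIntegrallyClosed.algebraMap_eq_of_integral (R := ℤ_[p]) h1.tower_top
    rw [RingHom.comp_apply, ← hy]
    exact y.2
  let G : 𝓞 K →+* ℤ_[p] := (g.comp (algebraMap (𝓞 K) K)).codRestrict (PadicInt.subring p) hint
  refine ⟨PadicInt.toZMod.comp G, ?_⟩
  have hG : G θ = z := Subtype.ext hg
  have : PadicInt.toZMod (z - (r : ℤ_[p])) = 0 := by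
    have : z - (r : ℤ_[p]) ∈ RingHom.ker (PadicInt.toZMod (p := p)) := by
      rw [PadicInt.ker_toZMod, IsLocalRing.mem_maximalIdeal, PadicInt.mem_nonunits]
      exact hzr.trans_le (PadicInt.norm_le_one _)
    exact this
  rw [RingHom.comp_apply, hG, ← sub_eq_zero]
  simpa using this

/-- A polynomial, Eisenstein at 5, whose root minus one generates the number field of the sieve. -/
noncomputable def quintic : ℤ[X] :=
  X ^ 5 - 5 * X ^ 4 - 10 * X ^ 3 + 50 * X ^ 2 + 25 * X - 85

theorem natDegree_quintic : quintic.natDegree = 5 := by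
  unfold quintic; compute_degree!

theorem monic_quintic : quintic.Monic := by
  unfold quintic; monicity!

theorem irreducible_quintic : Irreducible (quintic.map (algebraMap ℤ ℚ)) := by
  refine (monic_quintic.irreducible_iff_irreducible_map_fraction_map (K := ℚ)).1 ?_
  refine IsEisensteinAt.irreducible (𝓟 := Ideal.span {(5 : ℤ)}) ⟨?_, ?_, ?_⟩ ?_
    monic_quintic.isPrimitive (by simp [natDegree_quintic])
  · rw [monic_quintic.leadingCoeff, Ideal.mem_span_singleton]; norm_num
  · intro n hn
    rw [natDegree_quintic] at hn
    rw [Ideal.mem_span_singleton]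
    interval_cases n <;> simp [quintic, coeff_X, coeff_ofNat_mul, coeff_X_pow]
  · rw [Ideal.span_singleton_pow, Ideal.mem_span_singleton]
    simp [quintic, coeff_X, coeff_ofNat_mul, coeff_X_pow]
  · rw [Ideal.span_singleton_prime (by norm_num)]; norm_num

theorem exists_numberField : ∃ (K : Type) (_ : Field K) (_ : NumberField K) (v w : 𝓞 K),
    Module.finrank ℚ K = 5 ∧ BasisRelations v w ∧
    ∀ (p : ℕ) [Fact p.Prime] (r : ℤ), (p : ℤ) ∣ r ^ 5 - 20 * r ^ 3 + 80 * r - 24 →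
      ¬ (p : ℤ) ∣ 5 * r ^ 4 - 60 * r ^ 2 + 80 → ∃ g : 𝓞 K →+* ZMod p, g v = r := by
  let P : ℚ[X] := quintic.map (algebraMap ℤ ℚ)
  have : Fact (Irreducible P) := ⟨irreducible_quintic⟩
  let K := AdjoinRoot P
  have hdim : Module.finrank ℚ K = 5 := by
    rw [(AdjoinRoot.powerBasis irreducible_quintic.ne_zero).finrank,
      AdjoinRoot.powerBasis_dim, monic_quintic.natDegree_map, natDegree_quintic]
  have : FiniteDimensional ℚ K := FiniteDimensional.of_finrank_pos (by omega)
  have : CharZero K := algebraRat.charZero K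
  have : NumberField K := ⟨⟩
  let t : K := AdjoinRoot.root P
  have ht : aeval t quintic = 0 := by
    have : eval₂ (AdjoinRoot.of P) t P = 0 := AdjoinRoot.eval₂_root P
    rwa [eval₂_map, RingHom.ext_int ((AdjoinRoot.of P).comp (algebraMap ℤ ℚ)) (algebraMap ℤ K)]
      at this
  have hv : (t - 1) ^ 5 - 20 * (t - 1) ^ 3 + 80 * (t - 1) - 24 = 0 := by
    simp only [quintic, map_add, map_sub, map_mul, map_pow, map_ofNat, aeval_X] at ht
    linear_combination ht
  have hw : IsIntegral ℤ (4 - (t - 1) ^ 2 / 2) := by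
    refine ⟨X ^ 5 - 20 * X ^ 3 + 80 * X - 46, by monicity!, ?_⟩
    simp only [eval₂_add, eval₂_sub, eval₂_mul, eval₂_pow, eval₂_X, eval₂_ofNat]
    linear_combination (-1 / 32 * ((t - 1) ^ 5 - 20 * (t - 1) ^ 3 + 80 * (t - 1) + 24)) * hv
  obtain ⟨t₀, ht₀⟩ : ∃ t₀ : 𝓞 K, algebraMap (𝓞 K) K t₀ = t :=
    ⟨⟨t, quintic, monic_quintic, ht⟩, rfl⟩
  obtain ⟨w₀, hw₀⟩ : ∃ w₀ : 𝓞 K, algebraMap (𝓞 K) K w₀ = 4 - (t - 1) ^ 2 / 2 := ⟨⟨_, hw⟩, rfl⟩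
  refine ⟨K, inferInstance, inferInstance, t₀ - 1, w₀, hdim,
    ⟨RingOfIntegers.ext ?_, RingOfIntegers.ext ?_, RingOfIntegers.ext ?_⟩, ?_⟩
  any_goals simp only [map_add, map_sub, map_mul, map_pow, map_ofNat, map_one, ht₀, hw₀]
  · ring
  · linear_combination (-(t - 1) / 8) * hv
  · linear_combination 1 / 4 * hv
  · intro p _ r hr hr'
    have lift_root : ∀ {S : Type} [Field S] [CharZero S] (s : S), aeval s quintic = 0 →
        ∃ g : K →+* S, g (algebraMap (𝓞 K) K t₀) = s := fun {S} _ _ s hs => by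
      have hs' : eval₂ (algebraMap ℚ S) s P = 0 := by
        rwa [eval₂_map, RingHom.ext_int ((algebraMap ℚ S).comp (algebraMap ℤ ℚ)) (algebraMap ℤ S),
          ← aeval_def]
      exact ⟨AdjoinRoot.lift _ s hs', by rw [ht₀]; exact AdjoinRoot.lift_root hs'⟩
    obtain ⟨g, hg⟩ := exists_ringOfIntegers_hom_zmod lift_root p (r + 1)
      (by convert hr using 1; simp [quintic]; ring)
      (by convert hr' using 2; simp [quintic]; ring)
    exact ⟨g, by simp [hg]⟩

/-- The values of `(v, w)` at the places above 109 used in the sieve. -/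
def places109 : Fin 4 → ZMod 109 × ZMod 109 := ![(69, 76), (71, 45), (74, 100), (96, 83)]

/-- The values of `(v, w)` at the places above 181 used in the sieve. -/
def places181 : Fin 4 → ZMod 181 × ZMod 181 := ![(99, 81), (114, 22), (116, 154), (127, 175)]

/-- Discrete logarithms, to base 101, of the ninth powers of the units at the places above 109. -/
def logs109 : Fin 4 → Fin 4 → ℕ :=
  ![![7, 2, 10, 8], ![0, 5, 2, 3], ![2, 6, 10, 4], ![3, 9, 6, 2]]

/-- Discrete logarithms, to base 7, of the 15th powers of the units at the places above 181. -/
def logs181 : Fin 4 → Fin 4 → ℕ :=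
  ![![4, 5, 9, 11], ![9, 0, 10, 6], ![10, 6, 2, 7], ![2, 8, 7, 3]]

instance : Fact (Nat.Prime 109) := ⟨by norm_num⟩

instance inst_s10 : Fact (Nat.Prime 181) := ⟨by norm_num⟩

theorem pow_eq_pow_iff_modEq_of_orderOf {R : Type*} [Monoid R] {x : R} {n : ℕ} [NeZero n]
    (hx : orderOf x = n) {k l : ℕ} : x ^ k = x ^ l ↔ k ≡ l [MOD n] := by
  rw [IsOfFinOrder.pow_eq_pow_iff_modEq (orderOf_pos_iff.1 (hx ▸ NeZero.pos n)), hx]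

theorem pow_101_eq_pow_iff {k l : ℕ} : (101 : ZMod 109) ^ k = 101 ^ l ↔ k ≡ l [MOD 12] :=
  pow_eq_pow_iff_modEq_of_orderOf ((orderOf_eq_iff (by norm_num)).2 ⟨by decide, by decide⟩)

theorem pow_7_eq_pow_iff {k l : ℕ} : (7 : ZMod 181) ^ k = 7 ^ l ↔ k ≡ l [MOD 12] :=
  pow_eq_pow_iff_modEq_of_orderOf ((orderOf_eq_iff (by norm_num)).2 ⟨by decide, by decide⟩)

theorem BasisRelations.pow_unit_109 {R : Type*} [CommRing R] {v w : R} (h : BasisRelations v w)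
    {g : R →+* ZMod 109} {j : Fin 4} (hg : (g v, g w) = places109 j)
    (s : ℕ) (e : Fin 4 → ℕ) (η : Rˣ) :
    g ((-1) ^ s * (∏ i, h.unit i ^ e i) * η ^ 12 : Rˣ) ^ 9 =
      101 ^ (6 * s + ∑ i, logs109 j i * e i) := by
  refine pow_map_unit_eq (by norm_num) (by decide) g (fun i => ?_) s e η
  change g (basisCombination v w (unitCoords i)) ^ 9 = _
  obtain ⟨hv, hw⟩ : g v = (places109 j).1 ∧ g w = (places109 j).2 := Prod.ext_iff.1 hg
  rw [map_basisCombination, hv, hw]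
  clear hg hv hw
  revert i j
  decide

theorem BasisRelations.pow_unit_181 {R : Type*} [CommRing R] {v w : R} (h : BasisRelations v w)
    {g : R →+* ZMod 181} {j : Fin 4} (hg : (g v, g w) = places181 j)
    (s : ℕ) (e : Fin 4 → ℕ) (η : Rˣ) :
    g ((-1) ^ s * (∏ i, h.unit i ^ e i) * η ^ 12 : Rˣ) ^ 15 =
      7 ^ (6 * s + ∑ i, logs181 j i * e i) := by
  refine pow_map_unit_eq (by norm_num) (by decide) g (fun i => ?_) s e η
  change g (basisCombination v w (unitCoords i)) ^ 15 = _
  obtain ⟨hv, hw⟩ : g v = (places181 j).1 ∧ g w = (places181 j).2 := Prod.ext_iff.1 hg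
  rw [map_basisCombination, hv, hw]
  clear hg hv hw
  revert i j
  decide

/-- Up to twelfth powers, every unit is a signed product of the four units of `unitCoords`. -/
theorem exists_eq_unit_mul_pow {K : Type*} [Field K] [NumberField K]
    (hK : Module.finrank ℚ K = 5) {v w : 𝓞 K} (h : BasisRelations v w)
    {g : Fin 4 → 𝓞 K →+* ZMod 109} (hg : ∀ j, (g j v, g j w) = places109 j)
    {f : Fin 4 → 𝓞 K →+* ZMod 181} (hf : ∀ j, (f j v, f j w) = places181 j) (u : (𝓞 K)ˣ) :
    ∃ (s : ℕ) (e : Fin 4 → ℕ) (η : (𝓞 K)ˣ), u = (-1) ^ s * (∏ i, h.unit i ^ e i) * η ^ 12 := by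
  obtain ⟨_, hcard⟩ := card_units_quotient_pow_le K (by rw [hK]; decide) 12 (by norm_num)
  let F : Fin 2 × (Fin 4 → Fin 12) → (𝓞 K)ˣ ⧸ (powMonoidHom 12 : (𝓞 K)ˣ →* (𝓞 K)ˣ).range :=
    fun x => QuotientGroup.mk ((-1) ^ (x.1 : ℕ) * ∏ i, h.unit i ^ (x.2 i : ℕ))
  have hF : Function.Injective F := by
    rintro ⟨s, e⟩ ⟨s', e'⟩ hx
    obtain ⟨η, hη⟩ := QuotientGroup.eq.1 hx
    have hη' : (-1) ^ (s' : ℕ) * (∏ i, h.unit i ^ (e' i : ℕ)) * 1 ^ 12 =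
        (-1) ^ (s : ℕ) * (∏ i, h.unit i ^ (e i : ℕ)) * η ^ 12 := by
      rw [one_pow, mul_one, ← inv_mul_eq_iff_eq_mul]
      exact hη.symm
    have h109 (j : Fin 4) : 6 * (s' : ℕ) + ∑ i, logs109 j i * (e' i : ℕ) ≡
        6 * s + ∑ i, logs109 j i * (e i : ℕ) [MOD 12] := by
      rw [← pow_101_eq_pow_iff, ← h.pow_unit_109 (hg j) _ _ 1,
        ← h.pow_unit_109 (hg j) _ _ η, hη']
    have h181 (j : Fin 4) : 6 * (s' : ℕ) + ∑ i, logs181 j i * (e' i : ℕ) ≡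
        6 * s + ∑ i, logs181 j i * (e i : ℕ) [MOD 12] := by
      rw [← pow_7_eq_pow_iff, ← h.pow_unit_181 (hf j) _ _ 1,
        ← h.pow_unit_181 (hf j) _ _ η, hη']
    simp only [Fin.sum_univ_four, Nat.ModEq] at h109 h181
    have h₃ : (e 3 : ℕ) = e' 3 := by
      have := h109 2
      have := h181 2
      simp only [logs109, logs181, Matrix.cons_val] at *
      omega
    have h₁ : (e 1 : ℕ) = e' 1 := by
      have := h109 1
      have := h109 3
      have := h181 1
      simp only [logs109, logs181, Matrix.cons_val] at *
      omega
    have h₂ : (e 2 : ℕ) = e' 2 := by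
      have := h109 0
      have := h109 1
      have := h181 0
      simp only [logs109, logs181, Matrix.cons_val] at *
      omega
    have h₀ : (e 0 : ℕ) = e' 0 := by
      have := h109 0
      have := h109 2
      have := h109 3
      have := h181 0
      simp only [logs109, logs181, Matrix.cons_val] at *
      omega
    have hs : (s : ℕ) = s' := by
      have := h109 0
      simp only [logs109, Matrix.cons_val] at *
      omega
    refine Prod.ext (Fin.ext hs) (funext fun i => Fin.ext ?_)
    fin_cases i <;> assumption
  have hsurj := (hF.bijective_of_nat_card_le (by simpa [hK] using hcard)).2
  obtain ⟨⟨s, e⟩, hse⟩ := hsurj (QuotientGroup.mk u)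
  obtain ⟨η, hη⟩ := QuotientGroup.eq.1 hse
  exact ⟨s, fun i => e i, η, by rw [← inv_mul_eq_iff_eq_mul]; exact hη.symm⟩

theorem exists_places {K : Type*} [Field K] [NumberField K] {v w : 𝓞 K} (h : BasisRelations v w)
    (hroot : ∀ (p : ℕ) [Fact p.Prime] (r : ℤ), (p : ℤ) ∣ r ^ 5 - 20 * r ^ 3 + 80 * r - 24 →
      ¬ (p : ℤ) ∣ 5 * r ^ 4 - 60 * r ^ 2 + 80 → ∃ g : 𝓞 K →+* ZMod p, g v = r) :
    (∃ g : Fin 4 → 𝓞 K →+* ZMod 109, ∀ j, (g j v, g j w) = places109 j) ∧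
    ∃ f : Fin 4 → 𝓞 K →+* ZMod 181, ∀ j, (f j v, f j w) = places181 j := by
  constructor
  · suffices H : ∀ j, ∃ g : 𝓞 K →+* ZMod 109, (g v, g w) = places109 j by
      choose g hg using H
      exact ⟨g, hg⟩
    intro j
    obtain ⟨g, hg⟩ := hroot 109 ((![69, 71, 74, 96] : Fin 4 → ℤ) j)
      (by revert j; decide) (by revert j; decide)
    have hv : g v = (places109 j).1 := hg.trans
      ((by decide : ∀ i, (((![69, 71, 74, 96] : Fin 4 → ℤ) i : ℤ) : ZMod 109) = (places109 i).1) j)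
    exact ⟨g, Prod.ext hv (h.map_right g (by decide) hv
      ((by decide : ∀ i, (places109 i).1 ^ 2 = 8 - 2 * (places109 i).2) j))⟩
  · suffices H : ∀ j, ∃ g : 𝓞 K →+* ZMod 181, (g v, g w) = places181 j by
      choose g hg using H
      exact ⟨g, hg⟩
    intro j
    obtain ⟨g, hg⟩ := hroot 181 ((![99, 114, 116, 127] : Fin 4 → ℤ) j)
      (by revert j; decide) (by revert j; decide)
    have hv : g v = (places181 j).1 := hg.trans
      ((by decide : ∀ i, (((![99, 114, 116, 127] : Fin 4 → ℤ) i : ℤ) : ZMod 181) = (places181 i).1) j)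
    exact ⟨g, Prod.ext hv (h.map_right g (by decide) hv
      ((by decide : ∀ i, (places181 i).1 ^ 2 = 8 - 2 * (places181 i).2) j))⟩

/-- Relations between the power residue characters of a unit at places above 109 and 181. -/
theorem unit_relations {K : Type*} [Field K] [NumberField K]
    (hK : Module.finrank ℚ K = 5) {v w : 𝓞 K} (h : BasisRelations v w)
    {g : Fin 4 → 𝓞 K →+* ZMod 109} (hg : ∀ j, (g j v, g j w) = places109 j)
    {f : Fin 4 → 𝓞 K →+* ZMod 181} (hf : ∀ j, (f j v, f j w) = places181 j) (u : (𝓞 K)ˣ) (t : ℕ) :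
    (f 1 u ^ 45 = 7 ^ t → g 0 u ^ 63 * g 1 u ^ 18 * g 2 u ^ 90 * 101 ^ t = 1) ∧
    (f 2 u ^ 105 = 7 ^ t → g 0 u ^ 45 * g 1 u ^ 63 * g 3 u ^ 45 * 101 ^ t = 1) ∧
    (f 0 u ^ 15 * f 2 u ^ 120 * f 3 u ^ 15 = 7 ^ t → g 0 u ^ 9 * g 3 u ^ 81 * 101 ^ t = 1) := by
  obtain ⟨s, e, η, rfl⟩ := exists_eq_unit_mul_pow hK h hg hf u
  have h109 (j : Fin 4) (n : ℕ) := congrArg (· ^ n) (h.pow_unit_109 (hg j) s e η)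
  have h181 (j : Fin 4) (n : ℕ) := congrArg (· ^ n) (h.pow_unit_181 (hf j) s e η)
  simp only [← pow_mul, Fin.sum_univ_four] at h109 h181
  have one_eq : (1 : ZMod 109) = 101 ^ 0 := rfl
  refine ⟨fun ht => ?_, fun ht => ?_, fun ht => ?_⟩
  · rw [h181 1 3, pow_7_eq_pow_iff] at ht
    rw [h109 0 7, h109 1 2, h109 2 10, ← pow_add, ← pow_add, ← pow_add, one_eq, pow_101_eq_pow_iff]
    simp only [logs109, logs181, Matrix.cons_val, Nat.ModEq] at *
    omega
  · rw [h181 2 7, pow_7_eq_pow_iff] at ht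
    rw [h109 0 5, h109 1 7, h109 3 5, ← pow_add, ← pow_add, ← pow_add, one_eq, pow_101_eq_pow_iff]
    simp only [logs109, logs181, Matrix.cons_val, Nat.ModEq] at *
    omega
  · rw [h181 0 1, h181 2 8, h181 3 1, ← pow_add, ← pow_add, pow_7_eq_pow_iff] at ht
    rw [h109 0 1, h109 3 9, ← pow_add, ← pow_add, one_eq, pow_101_eq_pow_iff]
    simp only [logs109, logs181, Matrix.cons_val, Nat.ModEq] at *
    omega

/-- Coordinates of a linear form of norm `37 * a ^ 5 - 610 * a ^ 4 * b - ⋯`. -/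
def firstFactor (a b : ℤ) : Fin 5 → ℤ :=
  ![a + 2 * b, -12 * b, 2 * b, -a + 3 * b, 4 * b]

/-- Coordinates of the cofactor of `firstFactor a b` in its norm. -/
def firstCofactor (a b : ℤ) : Fin 5 → ℤ :=
  ![-27 * a ^ 4 + 164 * a ^ 3 * b + 6688 * a ^ 2 * b ^ 2 - 77440 * a * b ^ 3 + 212960 * b ^ 4,
    6 * a ^ 4 - 8 * a ^ 3 * b - 1914 * a ^ 2 * b ^ 2 + 19360 * a * b ^ 3 - 53240 * b ^ 4,
    4 * a ^ 4 - 26 * a ^ 3 * b - 836 * a ^ 2 * b ^ 2 + 9680 * a * b ^ 3 - 26620 * b ^ 4,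
    -11 * a ^ 4 + 95 * a ^ 3 * b + 2486 * a ^ 2 * b ^ 2 - 33880 * a * b ^ 3 + 106480 * b ^ 4,
    -2 * a ^ 4 + 10 * a ^ 3 * b + 682 * a ^ 2 * b ^ 2 - 8470 * a * b ^ 3 + 26620 * b ^ 4]

theorem BasisRelations.firstFactor_mul {R : Type*} [CommRing R] {v w : R} (h : BasisRelations v w)
    {a b : ℤ} (hab : 37 * a ^ 5 - 610 * a ^ 4 * b - 6600 * a ^ 3 * b ^ 2 + 193600 * a ^ 2 * b ^ 3 -
      1331000 * a * b ^ 4 + 2928200 * b ^ 5 = 1) :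
    basisCombination v w (firstFactor a b) * basisCombination v w (firstCofactor a b) = 1 := by
  apply h.mul_eq_one <;> simp only [firstFactor, firstCofactor, Matrix.cons_val]
  · linear_combination hab
  all_goals ring

/-- The exponent triples which the values of `firstFactor` at the places above 181 allow. -/
def firstTriples : List (ℕ × ℕ × ℕ) :=
  [(0, 0, 1), (0, 2, 1), (0, 6, 6), (0, 7, 0), (0, 7, 7), (0, 9, 6), (0, 11, 8), (3, 0, 5),
    (3, 1, 5), (3, 2, 11), (3, 4, 3), (3, 6, 7), (3, 7, 2), (3, 9, 1), (3, 9, 6), (3, 11, 1),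
    (6, 1, 10), (6, 2, 1), (6, 6, 6), (6, 7, 2), (6, 9, 2), (6, 9, 9), (6, 10, 9), (9, 2, 11),
    (9, 6, 5), (9, 7, 9), (9, 10, 3)]

theorem exists_mem_firstTriples : ∀ a < 181, ∀ b < 181,
    (37 * a ^ 5 + 114 * a ^ 4 * b + 97 * a ^ 3 * b ^ 2 + 111 * a ^ 2 * b ^ 3 +
      74 * a * b ^ 4 + 163 * b ^ 5) % 181 = 1 →
    ∃ t ∈ firstTriples, (68 * a + 39 * b) ^ 45 % 181 = 7 ^ t.1 % 181 ∧
      (66 * a + 102 * b) ^ 105 % 181 = 7 ^ t.2.1 % 181 ∧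
      (83 * a + 180 * b) ^ 15 * (66 * a + 102 * b) ^ 120 * (55 * a + 13 * b) ^ 15 % 181 =
        7 ^ t.2.2 % 181 := by
  decide +kernel

theorem not_mem_firstTriples : ∀ a < 109, ∀ b < 109,
    (37 * a ^ 5 + 44 * a ^ 4 * b + 49 * a ^ 3 * b ^ 2 + 16 * a ^ 2 * b ^ 3 +
      108 * a * b ^ 4 + 24 * b ^ 5) % 109 = 1 →
    ∀ t ∈ firstTriples,
    (41 * a + 106 * b) ^ 63 * (39 * a + 46 * b) ^ 18 * (36 * a + 10 * b) ^ 90 *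
      101 ^ t.1 % 109 = 1 →
    (41 * a + 106 * b) ^ 45 * (39 * a + 46 * b) ^ 63 * (14 * a + 36 * b) ^ 45 *
      101 ^ t.2.1 % 109 = 1 →
    (41 * a + 106 * b) ^ 9 * (14 * a + 36 * b) ^ 81 * 101 ^ t.2.2 % 109 ≠ 1 := by
  decide +kernel

theorem basisCombination_firstFactor {R : Type*} [CommRing R] (v w : R) (a b : ℤ) :
    basisCombination v w (firstFactor a b) = basisCombination v w (firstFactor 1 0) * a +
      basisCombination v w (firstFactor 0 1) * b := by
  simp only [basisCombination, firstFactor, Matrix.cons_val]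
  push_cast
  ring

theorem map_firstFactor_109 {R : Type*} [CommRing R] {v w : R} {g : R →+* ZMod 109}
    {j : Fin 4} (hg : (g v, g w) = places109 j) (a b : ℤ) :
    g (basisCombination v w (firstFactor a b)) =
      (![41, 39, 36, 14] : Fin 4 → ZMod 109) j * a +
        (![106, 46, 10, 36] : Fin 4 → ZMod 109) j * b := by
  obtain ⟨hv, hw⟩ : g v = (places109 j).1 ∧ g w = (places109 j).2 := Prod.ext_iff.1 hg
  rw [map_basisCombination, hv, hw, basisCombination_firstFactor]
  congr 2
  · clear hg hv hw
    revert j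
    decide
  · clear hg hv hw
    revert j
    decide

theorem map_firstFactor_181 {R : Type*} [CommRing R] {v w : R} {g : R →+* ZMod 181}
    {j : Fin 4} (hg : (g v, g w) = places181 j) (a b : ℤ) :
    g (basisCombination v w (firstFactor a b)) =
      (![83, 68, 66, 55] : Fin 4 → ZMod 181) j * a +
        (![180, 39, 102, 13] : Fin 4 → ZMod 181) j * b := by
  obtain ⟨hv, hw⟩ : g v = (places181 j).1 ∧ g w = (places181 j).2 := Prod.ext_iff.1 hg
  rw [map_basisCombination, hv, hw, basisCombination_firstFactor]
  congr 2
  · clear hg hv hw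
    revert j
    decide
  · clear hg hv hw
    revert j
    decide

theorem firstForm_ne_one (a b : ℤ) :
    37 * a ^ 5 - 610 * a ^ 4 * b - 6600 * a ^ 3 * b ^ 2 + 193600 * a ^ 2 * b ^ 3 -
      1331000 * a * b ^ 4 + 2928200 * b ^ 5 ≠ 1 := by
  intro hab
  obtain ⟨K, _, _, v, w, hK, h, hroot⟩ := exists_numberField
  obtain ⟨⟨g, hg⟩, f, hf⟩ := exists_places h hroot
  have hu := unit_relations hK h hg hf (Units.mkOfMulEqOne _ _ (h.firstFactor_mul hab))
  simp only [Units.val_mkOfMulEqOne] at hu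
  have h109 := congrArg (Int.cast (R := ZMod 109)) hab
  push_cast at h109
  have z109 : (109 : ZMod 109) = 0 := rfl
  have h181 := congrArg (Int.cast (R := ZMod 181)) hab
  push_cast at h181
  have z181 : (181 : ZMod 181) = 0 := rfl
  obtain ⟨t, ht, h₁, h₂, h₃⟩ := exists_mem_firstTriples _ (ZMod.val_lt (a : ZMod 181)) _
    (ZMod.val_lt (b : ZMod 181)) (by
      rw [← Nat.mod_eq_of_lt (by norm_num : 1 < 181), ← ZMod.natCast_eq_natCast_iff']
      push_cast
      simp only [ZMod.natCast_zmod_val]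
      linear_combination h181 + (4 * (a : ZMod 181) ^ 4 * b + 37 * (a : ZMod 181) ^ 3 * b ^ 2 -
        1069 * (a : ZMod 181) ^ 2 * b ^ 3 + 7354 * (a : ZMod 181) * b ^ 4 - 16177 * b ^ 5) * z181)
  simp only [← ZMod.natCast_eq_natCast_iff'] at h₁ h₂ h₃
  push_cast at h₁ h₂ h₃
  simp only [ZMod.natCast_zmod_val] at h₁ h₂ h₃
  have hu₁ := (hu t.1).1
  have hu₂ := (hu t.2.1).2.1
  have hu₃ := (hu t.2.2).2.2
  simp only [map_firstFactor_109 (hg _), map_firstFactor_181 (hf _), Matrix.cons_val]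
    at hu₁ hu₂ hu₃
  refine not_mem_firstTriples _ (ZMod.val_lt (a : ZMod 109)) _ (ZMod.val_lt (b : ZMod 109)) (by
      rw [← Nat.mod_eq_of_lt (by norm_num : 1 < 109), ← ZMod.natCast_eq_natCast_iff']
      push_cast
      simp only [ZMod.natCast_zmod_val]
      linear_combination h109 + (6 * (a : ZMod 109) ^ 4 * b + 61 * (a : ZMod 109) ^ 3 * b ^ 2 -
        1776 * (a : ZMod 109) ^ 2 * b ^ 3 + 12212 * (a : ZMod 109) * b ^ 4 -
          26864 * b ^ 5) * z109) t ht ?_ ?_ ?_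
  all_goals
    rw [← Nat.mod_eq_of_lt (by norm_num : 1 < 109), ← ZMod.natCast_eq_natCast_iff']
    push_cast
    simp only [ZMod.natCast_zmod_val]
  · exact hu₁ h₁
  · exact hu₂ h₂
  · exact hu₃ h₃

/-- Coordinates of a linear form of norm `206559 * a ^ 5 - 3106805 * a ^ 4 * b - ⋯`. -/
def secondFactor (a b : ℤ) : Fin 5 → ℤ :=
  ![-15 * a + 47 * b, 12 * a - 10 * b, -3 * a - 5 * b, 9 * a, -4 * a - 4 * b]

/-- Coordinates of the cofactor of `secondFactor a b` in its norm. -/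
def secondCofactor (a b : ℤ) : Fin 5 → ℤ :=
  ![182999 * a ^ 4 - 2088838 * a ^ 3 * b - 8494728 * a ^ 2 * b ^ 2 + 19572974 * a * b ^ 3 +
    945713 * b ^ 4,
    4076 * a ^ 4 - 6490 * a ^ 3 * b - 293892 * a ^ 2 * b ^ 2 + 469130 * a * b ^ 3 - 41344 * b ^ 4,
    -16097 * a ^ 4 + 179248 * a ^ 3 * b + 665754 * a ^ 2 * b ^ 2 - 1581284 * a * b ^ 3 -
      61361 * b ^ 4,
    61083 * a ^ 4 - 702181 * a ^ 3 * b - 2833311 * a ^ 2 * b ^ 2 + 6986373 * a * b ^ 3 +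
      308636 * b ^ 4,
    17409 * a ^ 4 - 185700 * a ^ 3 * b - 778896 * a ^ 2 * b ^ 2 + 1897626 * a * b ^ 3 +
      113721 * b ^ 4]

theorem BasisRelations.secondFactor_mul {R : Type*} [CommRing R] {v w : R} (h : BasisRelations v w)
    {a b : ℤ} (hab : 206559 * a ^ 5 - 3106805 * a ^ 4 * b - 799370 * a ^ 3 * b ^ 2 +
      61473750 * a ^ 2 * b ^ 3 - 89352965 * a * b ^ 4 - 4262969 * b ^ 5 = 1) :
    basisCombination v w (secondFactor a b) * basisCombination v w (secondCofactor a b) = 1 := by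
  apply h.mul_eq_one <;> simp only [secondFactor, secondCofactor, Matrix.cons_val]
  · linear_combination hab
  all_goals ring

/-- The exponent triples which the values of `secondFactor` at the places above 181 allow. -/
def secondTriples : List (ℕ × ℕ × ℕ) :=
  [(0, 0, 5), (0, 0, 10), (0, 2, 5), (0, 3, 9), (0, 4, 9), (0, 5, 3), (0, 7, 7), (0, 9, 11),
    (0, 10, 6), (3, 0, 1), (3, 0, 6), (3, 1, 1), (3, 4, 2), (3, 5, 5), (3, 9, 10), (3, 10, 6),
    (6, 1, 7), (6, 5, 3), (6, 9, 9), (6, 10, 1), (9, 0, 10), (9, 2, 0), (9, 3, 5), (9, 5, 5),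
    (9, 9, 10), (9, 10, 4), (9, 10, 11)]

theorem exists_mem_secondTriples : ∀ a < 181, ∀ b < 181,
    (38 * a ^ 5 + 60 * a ^ 4 * b + 107 * a ^ 3 * b ^ 2 + 177 * a ^ 2 * b ^ 3 +
      38 * a * b ^ 4 + 124 * b ^ 5) % 181 = 1 →
    ∃ t ∈ secondTriples, (108 * a + 45 * b) ^ 45 % 181 = 7 ^ t.1 % 181 ∧
      (5 * a + 150 * b) ^ 105 % 181 = 7 ^ t.2.1 % 181 ∧
      (45 * a + 59 * b) ^ 15 * (5 * a + 150 * b) ^ 120 * (14 * a + 79 * b) ^ 15 % 181 =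
        7 ^ t.2.2 % 181 := by
  decide +kernel

theorem not_mem_secondTriples : ∀ a < 109, ∀ b < 109,
    (4 * a ^ 5 + 22 * a ^ 4 * b + 36 * a ^ 3 * b ^ 2 + 39 * a ^ 2 * b ^ 3 +
      3 * a * b ^ 4 + 21 * b ^ 5) % 109 = 1 →
    ∀ t ∈ secondTriples,
    (56 * a + 7 * b) ^ 63 * (76 * a + 18 * b) ^ 18 * (21 * a + 107 * b) ^ 90 * 101 ^ t.1 % 109 = 1 →
    (56 * a + 7 * b) ^ 45 * (76 * a + 18 * b) ^ 63 * (100 * a + 44 * b) ^ 45 *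
      101 ^ t.2.1 % 109 = 1 →
    (56 * a + 7 * b) ^ 9 * (100 * a + 44 * b) ^ 81 * 101 ^ t.2.2 % 109 ≠ 1 := by
  decide +kernel

theorem basisCombination_secondFactor {R : Type*} [CommRing R] (v w : R) (a b : ℤ) :
    basisCombination v w (secondFactor a b) = basisCombination v w (secondFactor 1 0) * a +
      basisCombination v w (secondFactor 0 1) * b := by
  simp only [basisCombination, secondFactor, Matrix.cons_val]
  push_cast
  ring

theorem map_secondFactor_109 {R : Type*} [CommRing R] {v w : R} {g : R →+* ZMod 109}
    {j : Fin 4} (hg : (g v, g w) = places109 j) (a b : ℤ) :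
    g (basisCombination v w (secondFactor a b)) =
      (![56, 76, 21, 100] : Fin 4 → ZMod 109) j * a +
        (![7, 18, 107, 44] : Fin 4 → ZMod 109) j * b := by
  obtain ⟨hv, hw⟩ : g v = (places109 j).1 ∧ g w = (places109 j).2 := Prod.ext_iff.1 hg
  rw [map_basisCombination, hv, hw, basisCombination_secondFactor]
  congr 2
  · clear hg hv hw
    revert j
    decide
  · clear hg hv hw
    revert j
    decide

theorem map_secondFactor_181 {R : Type*} [CommRing R] {v w : R} {g : R →+* ZMod 181}
    {j : Fin 4} (hg : (g v, g w) = places181 j) (a b : ℤ) :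
    g (basisCombination v w (secondFactor a b)) =
      (![45, 108, 5, 14] : Fin 4 → ZMod 181) j * a +
        (![59, 45, 150, 79] : Fin 4 → ZMod 181) j * b := by
  obtain ⟨hv, hw⟩ : g v = (places181 j).1 ∧ g w = (places181 j).2 := Prod.ext_iff.1 hg
  rw [map_basisCombination, hv, hw, basisCombination_secondFactor]
  congr 2
  · clear hg hv hw
    revert j
    decide
  · clear hg hv hw
    revert j
    decide

theorem secondForm_ne_one (a b : ℤ) :
    206559 * a ^ 5 - 3106805 * a ^ 4 * b - 799370 * a ^ 3 * b ^ 2 +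
      61473750 * a ^ 2 * b ^ 3 - 89352965 * a * b ^ 4 - 4262969 * b ^ 5 ≠ 1 := by
  intro hab
  obtain ⟨K, _, _, v, w, hK, h, hroot⟩ := exists_numberField
  obtain ⟨⟨g, hg⟩, f, hf⟩ := exists_places h hroot
  have hu := unit_relations hK h hg hf (Units.mkOfMulEqOne _ _ (h.secondFactor_mul hab))
  simp only [Units.val_mkOfMulEqOne] at hu
  have h109 := congrArg (Int.cast (R := ZMod 109)) hab
  push_cast at h109
  have z109 : (109 : ZMod 109) = 0 := rfl
  have h181 := congrArg (Int.cast (R := ZMod 181)) hab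
  push_cast at h181
  have z181 : (181 : ZMod 181) = 0 := rfl
  obtain ⟨t, ht, h₁, h₂, h₃⟩ := exists_mem_secondTriples _ (ZMod.val_lt (a : ZMod 181)) _
    (ZMod.val_lt (b : ZMod 181)) (by
      rw [← Nat.mod_eq_of_lt (by norm_num : 1 < 181), ← ZMod.natCast_eq_natCast_iff']
      push_cast
      simp only [ZMod.natCast_zmod_val]
      linear_combination h181 + (-1141 * (a : ZMod 181) ^ 5 + 17165 * (a : ZMod 181) ^ 4 * b +
        4417 * (a : ZMod 181) ^ 3 * b ^ 2 - 339633 * (a : ZMod 181) ^ 2 * b ^ 3 +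
          493663 * (a : ZMod 181) * b ^ 4 + 23553 * b ^ 5) * z181)
  simp only [← ZMod.natCast_eq_natCast_iff'] at h₁ h₂ h₃
  push_cast at h₁ h₂ h₃
  simp only [ZMod.natCast_zmod_val] at h₁ h₂ h₃
  have hu₁ := (hu t.1).1
  have hu₂ := (hu t.2.1).2.1
  have hu₃ := (hu t.2.2).2.2
  simp only [map_secondFactor_109 (hg _), map_secondFactor_181 (hf _), Matrix.cons_val]
    at hu₁ hu₂ hu₃
  refine not_mem_secondTriples _ (ZMod.val_lt (a : ZMod 109)) _ (ZMod.val_lt (b : ZMod 109)) (by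
      rw [← Nat.mod_eq_of_lt (by norm_num : 1 < 109), ← ZMod.natCast_eq_natCast_iff']
      push_cast
      simp only [ZMod.natCast_zmod_val]
      linear_combination h109 + (-1895 * (a : ZMod 109) ^ 5 + 28503 * (a : ZMod 109) ^ 4 * b +
        7334 * (a : ZMod 109) ^ 3 * b ^ 2 - 563979 * (a : ZMod 109) ^ 2 * b ^ 3 +
          819752 * (a : ZMod 109) * b ^ 4 + 39110 * b ^ 5) * z109) t ht ?_ ?_ ?_
  all_goals
    rw [← Nat.mod_eq_of_lt (by norm_num : 1 < 109), ← ZMod.natCast_eq_natCast_iff']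
    push_cast
    simp only [ZMod.natCast_zmod_val]
  · exact hu₁ h₁
  · exact hu₂ h₂
  · exact hu₃ h₃

/-- Congruences modulo 2, 11 and 81 reduce the equation to one of two quintic unit equations. -/
theorem exists_form_eq_one {x y : ℤ}
    (h : x ^ 5 + 65 * x ^ 4 * y - 870 * x ^ 3 * y ^ 2 - 18990 * x ^ 2 * y ^ 3 +
      26325 * x * y ^ 4 + 255069 * y ^ 5 = -(2 ^ 5 * 3 ^ 4 * 11)) :
    (∃ a b : ℤ, 37 * a ^ 5 - 610 * a ^ 4 * b - 6600 * a ^ 3 * b ^ 2 + 193600 * a ^ 2 * b ^ 3 -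
      1331000 * a * b ^ 4 + 2928200 * b ^ 5 = 1) ∨
    ∃ a b : ℤ, 206559 * a ^ 5 - 3106805 * a ^ 4 * b - 799370 * a ^ 3 * b ^ 2 +
      61473750 * a ^ 2 * b ^ 3 - 89352965 * a * b ^ 4 - 4262969 * b ^ 5 = 1 := by
  have h₂ : (2 : ℤ) ∣ x - y := by
    refine Int.prime_two.dvd_of_dvd_pow (n := 5)
      ⟨-14256 - (35 * x ^ 4 * y - 440 * x ^ 3 * y ^ 2 - 9490 * x ^ 2 * y ^ 3 +
        13160 * x * y ^ 4 + 127535 * y ^ 5), ?_⟩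
    linear_combination h
  have h₁₁ : (11 : ℤ) ∣ x - 7 * y := by
    have hp : Prime (11 : ℤ) := by norm_num
    have : (11 : ℤ) ∣ (x - 7 * y) * (x - 4 * y) ^ 4 :=
      ⟨-2592 - (8 * x ^ 4 * y - 98 * x ^ 3 * y ^ 2 - 1642 * x ^ 2 * y ^ 3 +
        2207 * x * y ^ 4 + 23351 * y ^ 5), by linear_combination h⟩
    refine (hp.dvd_or_dvd this).resolve_right fun hc => ?_
    obtain ⟨c, hc⟩ := hp.dvd_of_dvd_pow hc
    obtain rfl : x = 4 * y + 11 * c := by linear_combination hc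
    have : 121 * (153 * y ^ 5 - 13585 * y ^ 4 * c - 22550 * y ^ 3 * c ^ 2 +
        3630 * y ^ 2 * c ^ 3 + 10285 * y * c ^ 4 + 1331 * c ^ 5) = -28512 := by
      linear_combination h
    omega
  by_cases h₃ : (3 : ℤ) ∣ x
  · obtain ⟨b, hb⟩ : (66 : ℤ) ∣ x + 15 * y := by omega
    refine Or.inl ⟨11 * b - y, b, mul_left_cancel₀ (by norm_num : (-28512 : ℤ) ≠ 0) ?_⟩
    obtain rfl : x = 66 * b - 15 * y := by linear_combination hb
    linear_combination h
  · have h₈₁ : (81 : ℤ) ∣ x - 40 * y := by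
      have hdvd : (81 : ℤ) ∣ (x - 40 * y) * (x ^ 4 + 3 * (35 * x ^ 3 * y + 1110 * x ^ 2 * y ^ 2 +
          38070 * x * y ^ 3 + 1531575 * y ^ 4)) :=
        ⟨-352 - 2272149 * y ^ 5, by linear_combination h⟩
      refine IsCoprime.dvd_of_dvd_mul_right ?_ hdvd
      rw [show (81 : ℤ) = 3 ^ 4 by norm_num]
      exact (IsCoprime.add_mul_left_right
        ((Int.prime_three.coprime_iff_not_dvd.2 h₃).pow_right) _).pow_left
    obtain ⟨b, hb⟩ : (891 : ℤ) ∣ x - 40 * y := by omega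
    obtain ⟨a, ha⟩ : (2 : ℤ) ∣ y + 17 * b := by omega
    refine Or.inr ⟨-a, b, mul_left_cancel₀ (by norm_num : (-28512 : ℤ) ≠ 0) ?_⟩
    obtain rfl : y = 2 * a - 17 * b := by linear_combination ha
    obtain rfl : x = 80 * a + 211 * b := by linear_combination hb
    linear_combination h

theorem no_thue_solutions_11 (x y : ℤ) :
    x ^ 5 + 65 * x ^ 4 * y - 870 * x ^ 3 * y ^ 2 - 18990 * x ^ 2 * y ^ 3 +
      26325 * x * y ^ 4 + 255069 * y ^ 5 ≠ -(2 ^ 5 * 3 ^ 4 * 11) := by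
  intro h
  obtain ⟨a, b, hab⟩ | ⟨a, b, hab⟩ := exists_form_eq_one h
  · exact firstForm_ne_one a b hab
  · exact secondForm_ne_one a b hab
end
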